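/- Let W be a 2-dimensional Coxeter group. Then its standard language 𝓛 satisfies condition (ii) of the definition of biautomaticity: there exists a constant C > 0 such that for all s ∈ S, all g, g' ∈ W with g' = gs, all words v, v' ∈ 𝓛 representing g, g' respectively, and all i ≥ 1, one has ℓ(v(i)⁻¹ v'(i)) ≤ C. (In fact one can take C = 5K, where K is the maximal word length of the longest element of ⟨T⟩ over all T ⊆ S with ⟨T⟩ finite.) -/

import Mathlib

namespace CoxeterPaper

open CoxeterSystem

attribute [local instance] Classical.propDecidable

variable {B : Type} [DecidableEq B] [Fintype B]
variable {W : Type} [Group W] {M : CoxeterMatrix B}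

/-- The right descent set `T(g) = {s ∈ S : ℓ(gs) < ℓ(g)}`, as a set of indices. -/
def descentSet (cs : CoxeterSystem M W) (g : W) : Set B :=
  {i | cs.IsRightDescent g i}

/-- The subgroup `⟨T(g)⟩` generated by the right descent set of `g`. -/
def descSubgroup (cs : CoxeterSystem M W) (g : W) : Subgroup W :=
  Subgroup.closure (cs.simple '' descentSet cs g)

/-- `w(g)`: the longest element of `⟨T(g)⟩` (defined via choice; for `g ≠ 1` the
subgroup `⟨T(g)⟩` is finite and has a unique longest element). -/
noncomputable def wg (cs : CoxeterSystem M W) (g : W) : W :=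
  if h : ∃ w₀ ∈ descSubgroup cs g, ∀ u ∈ descSubgroup cs g, cs.length u ≤ cs.length w₀
  then h.choose else 1

/-- `Π(g) = g · w(g)`. -/
noncomputable def PiMap (cs : CoxeterSystem M W) (g : W) : W := g * wg cs g

/-- The standard language `𝓛 ⊆ S*`: the empty word is in `𝓛` (and it is the only word of `𝓛`
representing the identity); a word `v` of length `n` representing `g ≠ 1` is in `𝓛` iff,
setting `k = ℓ(w(g))`, the prefix `v(n-k)` is in `𝓛` and `v(n-k+1, n)` represents `w(g)`. -/
inductive StdLang (cs : CoxeterSystem M W) : List B → Prop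
  | nil : StdLang cs []
  | step (v : List B) (hne : cs.wordProd v ≠ 1)
      (hpre : StdLang cs (v.take (v.length - cs.length (wg cs (cs.wordProd v)))))
      (hsuf : cs.wordProd (v.drop (v.length - cs.length (wg cs (cs.wordProd v))))
        = wg cs (cs.wordProd v)) : StdLang cs v

/-- A Coxeter group is 2-dimensional if every triple of distinct generators
generates an infinite subgroup. -/
def TwoDimensional (cs : CoxeterSystem M W) : Prop :=
  ∀ i j k : B, i ≠ j → i ≠ k → j ≠ k →
    Infinite (Subgroup.closure {cs.simple i, cs.simple j, cs.simple k} : Subgroup W)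

/-- The wall of the reflection `ρ` separates `g` and `h`. -/
def Separates (cs : CoxeterSystem M W) (ρ g h : W) : Prop :=
  Xor' (cs.length (ρ * g) < cs.length g) (cs.length (ρ * h) < cs.length h)

/-- `h` is adjacent to the wall of the reflection `ρ`. -/
def AdjacentWall (cs : CoxeterSystem M W) (ρ h : W) : Prop :=
  ∃ i : B, ρ = h * cs.simple i * h⁻¹

/-- The wall of `ρ'` separates `g` from the wall of `ρ`. -/
def SeparatesFromWall (cs : CoxeterSystem M W) (ρ' g ρ : W) : Prop :=
  ∀ h : W, AdjacentWall cs ρ h → Separates cs ρ' g h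

/-- `𝓦(g)`: the set of walls (identified with their reflections) separating `g` from the
identity and not separated from `g` by any other wall. -/
def WallsNear (cs : CoxeterSystem M W) (g : W) : Set W :=
  {ρ | cs.IsReflection ρ ∧ cs.length (ρ * g) < cs.length g ∧
    ∀ ρ' : W, cs.IsReflection ρ' → ρ' ≠ ρ → ¬ SeparatesFromWall cs ρ' g ρ}

set_option linter.unusedSectionVars false

section Exchange

variable (cs : CoxeterSystem M W)

/-- The action of the simple reflection `s i` on `W × ZMod 2` which conjugates the first coordinate
and flips the second one when the first coordinate is `s i`. -/
noncomputable def signedConj (i : B) : Function.End (W × ZMod 2) := fun p ↦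
  (cs.simple i * p.1 * cs.simple i, p.2 + if p.1 = cs.simple i then 1 else 0)

theorem signedConj_mul_pow_apply (i j : B) (n : ℕ) (t : W) (e : ZMod 2) :
    ((signedConj cs i * signedConj cs j) ^ n) (t, e) =
      ((cs.simple i * cs.simple j) ^ n * t * ((cs.simple i * cs.simple j) ^ n)⁻¹,
        e + ∑ k ∈ Finset.range (2 * n),
          if t = cs.simple j * (cs.simple i * cs.simple j) ^ k then 1 else 0) := by
  induction n with
  | zero =>
    simp only [pow_zero, one_mul, mul_zero, Finset.range_zero, Finset.sum_empty, add_zero,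
      inv_one, mul_one]
    rfl
  | succ n ih =>
    rw [pow_succ']
    change signedConj cs i (signedConj cs j (((signedConj cs i * signedConj cs j) ^ n) (t, e))) = _
    rw [ih]
    set r := cs.simple i * cs.simple j with hr
    have hji : cs.simple j * cs.simple i = r⁻¹ := by simp [hr]
    have hj : cs.simple j * r = r⁻¹ * cs.simple j := by rw [← hji, hr, mul_assoc]
    have hconj : ∀ k : ℕ, cs.simple j * r ^ k = (r ^ k)⁻¹ * cs.simple j := by
      intro k
      induction k with
      | zero => simp
      | succ k ihk =>
        rw [pow_succ', ← mul_assoc, hj, mul_assoc, ihk, ← mul_assoc, ← mul_inv_rev, ← pow_succ,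
          pow_succ']
    have h1 : r ^ n * t * (r ^ n)⁻¹ = cs.simple j ↔ t = cs.simple j * r ^ (2 * n) := by
      rw [two_mul, pow_add, ← mul_assoc, hconj n]
      constructor
      · intro h; rw [← h]; group
      · intro h; rw [h]; group
    have h2 : cs.simple j * (r ^ n * t * (r ^ n)⁻¹) * cs.simple j = cs.simple i ↔
        t = cs.simple j * r ^ (2 * n + 1) := by
      have h3 : cs.simple j * r ^ (2 * n + 1) =
          (r ^ n)⁻¹ * (cs.simple j * cs.simple i * cs.simple j) * r ^ n := by
        rw [show 2 * n + 1 = n + (1 + n) by ring, pow_add, ← mul_assoc, hconj n, pow_add, pow_one,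
          hr]
        simp only [mul_assoc]
      rw [h3]
      constructor
      · intro h; rw [← h]; simp [mul_assoc]
      · intro h; rw [h]; simp [mul_assoc]
    rw [show 2 * (n + 1) = 2 * n + 1 + 1 by ring, Finset.sum_range_succ, Finset.sum_range_succ]
    simp only [signedConj, h1, h2]
    refine Prod.ext ?_ ?_
    · rw [pow_succ' r n, mul_inv_rev, ← hji, hr]
      simp only [mul_assoc]
    · simp only [add_assoc]

theorem isLiftable_signedConj : M.IsLiftable (signedConj cs) := by
  intro i j
  funext ⟨t, e⟩
  rw [signedConj_mul_pow_apply, two_mul, Finset.sum_range_add]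
  simp only [pow_add, cs.simple_mul_simple_pow, one_mul, inv_one, mul_one,
    CharTwo.add_self_eq_zero, add_zero]
  rfl

theorem prod_map_signedConj_apply (ω : List B) (t : W) (e : ZMod 2) :
    (ω.map (signedConj cs)).prod (t, e) =
      (cs.wordProd ω * t * (cs.wordProd ω)⁻¹, e + (cs.rightInvSeq ω).count t) := by
  induction ω with
  | nil =>
    simp only [List.map_nil, List.prod_nil, cs.wordProd_nil, one_mul, inv_one, mul_one,
      cs.rightInvSeq_nil, List.count_nil, Nat.cast_zero, add_zero]
    rfl
  | cons i ω ih =>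
    rw [List.map_cons, List.prod_cons]
    change signedConj cs i ((ω.map (signedConj cs)).prod (t, e)) = _
    rw [ih]
    have h : cs.wordProd ω * t * (cs.wordProd ω)⁻¹ = cs.simple i ↔
        (cs.wordProd ω)⁻¹ * cs.simple i * cs.wordProd ω = t := by
      constructor
      · intro h; rw [← h]; group
      · intro h; rw [← h]; group
    simp only [signedConj, h]
    simp only [rightInvSeq, List.count_cons, cs.wordProd_cons, mul_inv_rev,
      cs.inv_simple, mul_assoc, beq_iff_eq, Nat.cast_add, Nat.cast_ite, Nat.cast_one,
      Nat.cast_zero, add_assoc]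

theorem count_rightInvSeq_eq_of_wordProd_eq {ω ω' : List B} (h : cs.wordProd ω = cs.wordProd ω')
    (t : W) : ((cs.rightInvSeq ω).count t : ZMod 2) = (cs.rightInvSeq ω').count t := by
  have key : ∀ ω : List B, cs.lift ⟨signedConj cs, isLiftable_signedConj cs⟩ (cs.wordProd ω) =
      (ω.map (signedConj cs)).prod := by
    intro ω
    rw [CoxeterSystem.wordProd, map_list_prod, List.map_map]
    congr 2
    funext i
    exact cs.lift_apply_simple (isLiftable_signedConj cs) i
  have := congrFun ((key ω).symm.trans ((congrArg _ h).trans (key ω'))) (t, 0)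
  rw [prod_map_signedConj_apply, prod_map_signedConj_apply] at this
  simpa using congrArg Prod.snd this

theorem exists_wordProd_mul_simple_eq_eraseIdx {ω : List B} {i : B}
    (h : cs.IsRightDescent (cs.wordProd ω) i) :
    ∃ j < ω.length, cs.wordProd ω * cs.simple i = cs.wordProd (ω.eraseIdx j) := by
  obtain ⟨ω', hω', hprod⟩ := cs.exists_isReduced (cs.wordProd ω * cs.simple i)
  have hω : cs.wordProd (ω' ++ [i]) = cs.wordProd ω := by
    rw [cs.wordProd_append, ← hprod]; simp
  have hred : cs.IsReduced (ω' ++ [i]) := by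
    rw [CoxeterSystem.IsReduced, hω, List.length_append, ← hω'.eq, ← hprod]
    exact ((cs.isRightDescent_iff).1 h).symm
  have hmem : cs.simple i ∈ cs.rightInvSeq (ω' ++ [i]) := by
    rw [← List.concat_eq_append, cs.rightInvSeq_concat]
    simp
  have hcount := count_rightInvSeq_eq_of_wordProd_eq cs hω (cs.simple i)
  rw [List.count_eq_one_of_mem hred.nodup_rightInvSeq hmem] at hcount
  have hmem' : cs.simple i ∈ cs.rightInvSeq ω := by
    by_contra hn
    rw [List.count_eq_zero_of_not_mem hn] at hcount
    simp at hcount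
  obtain ⟨j, hj, hji⟩ := List.mem_iff_getElem.1 hmem'
  refine ⟨j, by simpa using hj, ?_⟩
  rw [← cs.wordProd_mul_getD_rightInvSeq, List.getD_eq_getElem _ 1 hj, hji]

end Exchange

section Desc

variable (cs : CoxeterSystem M W)

/-- `s` is a simple reflection and a right descent of `x`. -/
def Desc (x s : W) : Prop :=
  s ∈ Set.range cs.simple ∧ cs.length (x * s) < cs.length x

variable {cs} {x y z s t r u w : W}

theorem mul_self_of_mem_range (hs : s ∈ Set.range cs.simple) : s * s = 1 := by
  obtain ⟨i, rfl⟩ := hs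
  exact cs.simple_mul_simple_self i

theorem mul_mul_self_of_mem_range (hs : s ∈ Set.range cs.simple) (x : W) : x * s * s = x := by
  rw [mul_assoc, mul_self_of_mem_range hs, mul_one]

theorem inv_of_mem_range (hs : s ∈ Set.range cs.simple) : s⁻¹ = s :=
  inv_eq_of_mul_eq_one_left (mul_self_of_mem_range hs)

theorem length_of_mem_range (hs : s ∈ Set.range cs.simple) : cs.length s = 1 := by
  obtain ⟨i, rfl⟩ := hs
  exact cs.length_simple i

theorem length_mul_of_mem_range (hs : s ∈ Set.range cs.simple) (x : W) :
    cs.length (x * s) = cs.length x + 1 ∨ cs.length (x * s) + 1 = cs.length x := by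
  obtain ⟨i, rfl⟩ := hs
  exact cs.length_mul_simple x i

theorem Desc.length (h : Desc cs x s) : cs.length (x * s) + 1 = cs.length x := by
  have := h.2
  rcases length_mul_of_mem_range h.1 x with h | h <;> omega

theorem length_mul_of_not_desc (hs : s ∈ Set.range cs.simple) (h : ¬ Desc cs x s) :
    cs.length (x * s) = cs.length x + 1 := by
  rcases length_mul_of_mem_range hs x with h' | h'
  · exact h'
  · exact absurd ⟨hs, by omega⟩ h

theorem Desc.not_desc_mul (h : Desc cs x s) : ¬ Desc cs (x * s) s := fun h' ↦ by
  have := h'.length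
  rw [mul_mul_self_of_mem_range h.1] at this
  have := h.length
  omega

theorem desc_mul_self_of_not_desc (hs : s ∈ Set.range cs.simple) (h : ¬ Desc cs x s) :
    Desc cs (x * s) s := by
  refine ⟨hs, ?_⟩
  rw [mul_mul_self_of_mem_range hs, length_mul_of_not_desc hs h]
  omega

theorem Desc.of_mul (hl : cs.length (x * y) = cs.length x + cs.length y)
    (h : Desc cs (x * y) s) : cs.length (x * (y * s * y⁻¹)) < cs.length x ∨ Desc cs y s := by
  obtain ⟨ω₁, h₁, rfl⟩ := cs.exists_isReduced x
  obtain ⟨ω₂, h₂, rfl⟩ := cs.exists_isReduced y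
  obtain ⟨⟨i, rfl⟩, hlt⟩ := h
  rw [← cs.wordProd_append] at hlt
  obtain ⟨j, hj, he⟩ := exists_wordProd_mul_simple_eq_eraseIdx cs (i := i) hlt
  rw [List.length_append] at hj
  rcases lt_or_ge j ω₁.length with hj' | hj'
  · left
    rw [List.eraseIdx_append_of_lt_length hj', cs.wordProd_append, cs.wordProd_append] at he
    have : cs.wordProd ω₁ * (cs.wordProd ω₂ * cs.simple i * (cs.wordProd ω₂)⁻¹) =
        cs.wordProd (ω₁.eraseIdx j) := by
      rw [← mul_assoc, ← mul_assoc, he]; simp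
    rw [this, h₁.eq]
    refine (cs.length_wordProd_le _).trans_lt ?_
    rw [List.length_eraseIdx_of_lt hj']
    omega
  · right
    rw [List.eraseIdx_append_of_length_le hj', cs.wordProd_append, cs.wordProd_append,
      mul_assoc, mul_left_cancel_iff] at he
    refine ⟨⟨i, rfl⟩, ?_⟩
    rw [he, h₂.eq]
    refine (cs.length_wordProd_le _).trans_lt ?_
    rw [List.length_eraseIdx_of_lt (by omega)]
    omega

theorem exists_isReduced_of_mem_closure {J : Set W} (hJ : J ⊆ Set.range cs.simple)
    (hw : w ∈ Subgroup.closure J) :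
    ∃ ω : List B, cs.IsReduced ω ∧ w = cs.wordProd ω ∧ ∀ i ∈ ω, cs.simple i ∈ J := by
  have step : ∀ x s, s ∈ J →
      (∃ ω : List B, cs.IsReduced ω ∧ x = cs.wordProd ω ∧ ∀ i ∈ ω, cs.simple i ∈ J) →
      ∃ ω : List B, cs.IsReduced ω ∧ x * s = cs.wordProd ω ∧ ∀ i ∈ ω, cs.simple i ∈ J := by
    rintro _ s hs ⟨ω, hω, rfl, hωJ⟩
    obtain ⟨i, rfl⟩ := hJ hs
    by_cases hd : cs.IsRightDescent (cs.wordProd ω) i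
    · obtain ⟨j, hj, he⟩ := exists_wordProd_mul_simple_eq_eraseIdx cs hd
      refine ⟨ω.eraseIdx j, ?_, he, fun k hk ↦ hωJ k (List.mem_of_mem_eraseIdx hk)⟩
      rw [CoxeterSystem.IsReduced, ← he, List.length_eraseIdx_of_lt hj]
      have := (cs.isRightDescent_iff).1 hd
      rw [hω.eq] at this
      omega
    · refine ⟨ω ++ [i], ?_, by simp [cs.wordProd_append], ?_⟩
      · rw [CoxeterSystem.IsReduced, cs.wordProd_append, cs.wordProd_singleton,
          (cs.not_isRightDescent_iff).1 hd, hω.eq]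
        simp
      · intro k hk
        rcases List.mem_append.1 hk with hk | hk
        · exact hωJ k hk
        · rw [List.mem_singleton.1 hk]; exact hs
  induction hw using Subgroup.closure_induction_right with
  | one => exact ⟨[], by simp [CoxeterSystem.IsReduced], by simp, by simp⟩
  | mul_right x _ y hy ih => exact step x y hy ih
  | mul_inv_cancel x _ y hy ih =>
    rw [inv_of_mem_range (hJ hy)]
    exact step x y hy ih

theorem exists_desc_of_mem_closure {J : Set W} (hJ : J ⊆ Set.range cs.simple)
    (hw : w ∈ Subgroup.closure J) (hne : w ≠ 1) : ∃ s ∈ J, Desc cs w s := by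
  obtain ⟨ω, hω, rfl, hωJ⟩ := exists_isReduced_of_mem_closure hJ hw
  rcases List.eq_nil_or_concat ω with rfl | ⟨ω, i, rfl⟩
  · simp at hne
  · refine ⟨cs.simple i, hωJ i (by simp), ⟨i, rfl⟩, ?_⟩
    rw [hω.eq]
    simp only [List.concat_eq_append, cs.wordProd_append, cs.wordProd_singleton,
      cs.simple_mul_simple_cancel_right, List.length_append, List.length_singleton]
    exact Nat.lt_succ_of_le (cs.length_wordProd_le _)

theorem length_mul_add_length_of_desc {J : Set W} (hJ : ∀ s ∈ J, Desc cs u s)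
    (hw : w ∈ Subgroup.closure J) : cs.length (u * w) + cs.length w = cs.length u := by
  have hJ' : J ⊆ Set.range cs.simple := fun s hs ↦ (hJ s hs).1
  induction hn : cs.length w generalizing w with
  | zero => rw [cs.length_eq_zero_iff.1 hn]; simp
  | succ n ih =>
    have hne : w⁻¹ ≠ 1 := by
      intro h
      rw [inv_eq_one.1 h] at hn
      simp at hn
    obtain ⟨s, hs, hd⟩ := exists_desc_of_mem_closure hJ' (inv_mem hw) hne
    have hsl : cs.length (s * w) = n := by
      have := hd.length
      rw [← cs.length_inv, mul_inv_rev, inv_inv, inv_of_mem_range hd.1, cs.length_inv, hn] at this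
      omega
    have hih := ih (w := s * w) (mul_mem (Subgroup.subset_closure hs) hw) hsl
    have hu : u * (s * w) * (s * w)⁻¹ = u := by group
    have hdu := hJ s hs
    rw [← hu] at hdu
    rcases hdu.of_mul (by rw [hu, cs.length_inv, ← hih, hsl]) with h | h
    · have e : u * (s * w) * ((s * w)⁻¹ * s * (s * w)⁻¹⁻¹) = u * w := by
        rw [inv_inv, mul_inv_rev, inv_of_mem_range hd.1, mul_mul_self_of_mem_range hd.1,
          ← mul_assoc w⁻¹, mul_assoc u, mul_assoc s w, ← mul_assoc w, ← mul_assoc w]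
        simp [← mul_assoc, mul_mul_self_of_mem_range hd.1]
      rw [e] at h
      have := cs.length_mul_le (u * w) w⁻¹
      rw [mul_inv_cancel_right, cs.length_inv] at this
      omega
    · have := h.length
      rw [mul_inv_rev, inv_of_mem_range hd.1, mul_mul_self_of_mem_range hd.1, cs.length_inv,
        ← inv_of_mem_range hd.1, ← mul_inv_rev, cs.length_inv, hsl] at this
      omega

theorem finite_setOf_length_le (n : ℕ) : {w : W | cs.length w ≤ n}.Finite := by
  refine ((List.finite_length_le B n).image cs.wordProd).subset fun w hw ↦ ?_
  obtain ⟨ω, hω, rfl⟩ := cs.exists_isReduced w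
  exact ⟨ω, by simpa [hω.eq] using hw, rfl⟩

theorem finite_closure_of_desc {J : Set W} (hJ : ∀ s ∈ J, Desc cs u s) :
    (Subgroup.closure J : Set W).Finite :=
  (finite_setOf_length_le (cs := cs) (cs.length u)).subset fun w hw ↦ by
    have := length_mul_add_length_of_desc hJ hw
    change cs.length w ≤ cs.length u
    omega

theorem TwoDimensional.not_finite (h2 : TwoDimensional cs) (hs : s ∈ Set.range cs.simple)
    (ht : t ∈ Set.range cs.simple) (hr : r ∈ Set.range cs.simple) (hst : s ≠ t) (hsr : s ≠ r)
    (htr : t ≠ r) : ¬ (Subgroup.closure {s, t, r} : Set W).Finite := by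
  obtain ⟨i, rfl⟩ := hs
  obtain ⟨j, rfl⟩ := ht
  obtain ⟨k, rfl⟩ := hr
  have := h2 i j k (by rintro rfl; exact hst rfl) (by rintro rfl; exact hsr rfl)
    (by rintro rfl; exact htr rfl)
  exact fun hf ↦ this.not_finite hf.to_subtype

theorem TwoDimensional.eq_or_eq_of_desc (h2 : TwoDimensional cs) (hs : Desc cs x s)
    (ht : Desc cs x t) (hst : s ≠ t) (hr : Desc cs x r) : r = s ∨ r = t := by
  by_contra! h
  refine h2.not_finite hs.1 ht.1 hr.1 hst h.1.symm h.2.symm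
    (finite_closure_of_desc (cs := cs) (u := x) ?_)
  rintro _ (rfl | rfl | rfl) <;> assumption

/-- Two elements of a coset of `⟨J⟩` without descents in `J` agree, if `J` consists of descents of
some element of the coset. -/
theorem eq_of_not_desc {J : Set W} (hJ : ∀ s ∈ J, Desc cs u s)
    (hy : u⁻¹ * y ∈ Subgroup.closure J) (hz : u⁻¹ * z ∈ Subgroup.closure J)
    (hyJ : ∀ s ∈ J, ¬ Desc cs y s) (hzJ : ∀ s ∈ J, ¬ Desc cs z s) : y = z := by
  have max : ∀ y, u⁻¹ * y ∈ Subgroup.closure J → (∀ s ∈ J, ¬ Desc cs y s) →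
      ∀ s ∈ J, Desc cs (u⁻¹ * y) s := by
    intro y hy hyJ s hs
    by_contra hn
    have h1 := length_mul_add_length_of_desc hJ hy
    have h2 := length_mul_add_length_of_desc hJ (mul_mem hy (Subgroup.subset_closure hs))
    have h3 := length_mul_of_not_desc (hJ s hs).1 hn
    have h4 := length_mul_of_not_desc (hJ s hs).1 (hyJ s hs)
    rw [← mul_assoc] at h2
    rw [mul_inv_cancel_left] at h1 h2
    omega
  have hyz := length_mul_add_length_of_desc (max y hy hyJ) (mul_mem (inv_mem hy) hz)
  have hzy := length_mul_add_length_of_desc (max z hz hzJ) (mul_mem (inv_mem hz) hy)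
  rw [mul_inv_cancel_left] at hyz hzy
  have h0 : cs.length ((u⁻¹ * y)⁻¹ * (u⁻¹ * z)) = 0 := by omega
  exact mul_left_cancel (inv_mul_eq_one.1 (cs.length_eq_zero_iff.1 h0))

end Desc

section Dihedral

/-- The order of the product of two elements. -/
noncomputable def ord (s t : W) : ℕ := orderOf (s * t)

theorem ord_comm (s t : W) : ord s t = ord t s := by
  rw [ord, ord, ← orderOf_injective (MulAut.conj t).toMonoidHom (MulAut.conj t).injective]
  simp [mul_assoc]

/-- The alternating product `s * t * s * ⋯` with `n` factors. -/
def altProd : W → W → ℕ → W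
  | _, _, 0 => 1
  | s, t, n + 1 => s * altProd t s n

variable {cs : CoxeterSystem M W} {x s t r : W}

theorem desc_of_mem_pair (hs : Desc cs x s) (ht : Desc cs x t) :
    ∀ r ∈ ({s, t} : Set W), Desc cs x r := by
  rintro _ (rfl | rfl) <;> assumption

theorem altProd_mem_closure (s t : W) (n : ℕ) : altProd s t n ∈ Subgroup.closure {s, t} := by
  induction n generalizing s t with
  | zero => exact one_mem _
  | succ n ih =>
    refine mul_mem (Subgroup.subset_closure (by simp)) ?_
    rw [Set.pair_comm]
    exact ih t s

theorem length_altProd_le (hs : s ∈ Set.range cs.simple) (ht : t ∈ Set.range cs.simple) (n : ℕ) :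
    cs.length (altProd s t n) ≤ n := by
  induction n generalizing s t with
  | zero => simp [altProd]
  | succ n ih =>
    have := cs.length_mul_le s (altProd t s n)
    rw [length_of_mem_range hs] at this
    have := ih ht hs
    rw [altProd]
    omega

theorem altProd_mul_inv (hs : s ∈ Set.range cs.simple) (ht : t ∈ Set.range cs.simple) (n : ℕ) :
    altProd s t n * (altProd t s n)⁻¹ = (s * t) ^ n := by
  induction n generalizing s t with
  | zero => simp [altProd]
  | succ n ih =>
    rw [altProd, altProd, mul_inv_rev, inv_of_mem_range ht, mul_assoc, ← mul_assoc _ _ t,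
      ih ht hs]
    clear ih
    induction n with
    | zero => simp
    | succ n ih => rw [pow_succ, mul_assoc, mul_assoc t s t, ← mul_assoc, ← mul_assoc,
        mul_assoc s _ t, ih, ← pow_succ]

theorem length_altProd_of_pow_ne_one (hs : s ∈ Set.range cs.simple) (ht : t ∈ Set.range cs.simple)
    {n : ℕ} (h : ∀ k, 0 < k → k < n → (s * t) ^ k ≠ 1) :
    cs.length (altProd s t n) = n ∧ cs.length (altProd t s n) = n := by
  induction n with
  | zero => simp [altProd]
  | succ n ih =>
    obtain ⟨h1, h2⟩ := ih fun k hk hkn ↦ h k hk (by omega)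
    have key : ∀ s t, s ∈ Set.range cs.simple → t ∈ Set.range cs.simple →
        cs.length (altProd s t n) = n → cs.length (altProd t s n) = n →
        altProd s t n * (altProd t s n)⁻¹ ≠ 1 ∨ n = 0 →
        cs.length (altProd s t (n + 1)) = n + 1 := by
      intro s t hs ht h1 h2 hne
      rcases hne with hne | rfl
      swap
      · simpa [altProd] using length_of_mem_range hs
      by_contra hl
      have hds : Desc cs (altProd t s n)⁻¹ s := by
        by_contra hd
        apply hl
        have := length_mul_of_not_desc hs hd
        rwa [← cs.length_inv, mul_inv_rev, inv_of_mem_range hs, inv_inv, cs.length_inv, h2]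
          at this
      have hdt : Desc cs (altProd t s n)⁻¹ t := by
        refine ⟨ht, ?_⟩
        rw [← cs.length_inv, mul_inv_rev, inv_of_mem_range ht, inv_inv, cs.length_inv, h2]
        rcases n with _ | n
        · simp [altProd] at hne
        · rw [altProd, ← mul_assoc, mul_self_of_mem_range ht, one_mul]
          exact Nat.lt_succ_of_le (length_altProd_le hs ht n)
      have := length_mul_add_length_of_desc (desc_of_mem_pair hds hdt)
        (altProd_mem_closure s t n)
      rw [cs.length_inv, h1, h2] at this
      have := cs.length_eq_zero_iff.1 (by omega : cs.length ((altProd t s n)⁻¹ * altProd s t n) = 0)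
      apply hne
      rw [inv_mul_eq_one.1 this, mul_inv_cancel]
    refine ⟨key s t hs ht h1 h2 ?_, key t s ht hs h2 h1 ?_⟩ <;>
    rcases Nat.eq_zero_or_pos n with hn | hn <;> try exact Or.inr hn
    · left
      rw [altProd_mul_inv hs ht]
      exact h n hn (by omega)
    · left
      rw [altProd_mul_inv ht hs]
      intro h'
      apply h n hn (by omega)
      have : s * t = (t * s)⁻¹ := by
        rw [mul_inv_rev, inv_of_mem_range hs, inv_of_mem_range ht]
      rw [this, inv_pow, h', inv_one]

theorem length_mul_altProd (hs : Desc cs x s) (ht : Desc cs x t) {n : ℕ} (h : n ≤ ord s t) :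
    cs.length (x * altProd s t n) + n = cs.length x := by
  have h1 := (length_altProd_of_pow_ne_one hs.1 ht.1 (n := n) fun k hk hkn h' ↦
    absurd (orderOf_le_of_pow_eq_one hk h') (by rw [ord] at h; omega)).1
  have h2 := length_mul_add_length_of_desc (desc_of_mem_pair hs ht) (altProd_mem_closure s t n)
  rwa [h1] at h2

theorem finite_closure_pair_of_ord_ne_zero (hs : s ∈ Set.range cs.simple)
    (ht : t ∈ Set.range cs.simple) (h : ord s t ≠ 0) :
    (Subgroup.closure {s, t} : Set W).Finite := by
  have hm : ∀ k : ℤ, (s * t) ^ k * t = (s * t) ^ (k - 1) * s := by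
    intro k
    rw [zpow_sub_one, mul_inv_rev, inv_of_mem_range hs, inv_of_mem_range ht, mul_assoc, mul_assoc,
      mul_self_of_mem_range hs, mul_one]
  have hfin : (Subgroup.zpowers (s * t) : Set W).Finite :=
    finite_zpowers.2 (orderOf_pos_iff.1 (Nat.pos_of_ne_zero h))
  refine (hfin.union (hfin.image (· * s))).subset fun w hw ↦ ?_
  have step : ∀ x r, r ∈ ({s, t} : Set W) → (∃ k : ℤ, x = (s * t) ^ k ∨ x = (s * t) ^ k * s) →
      ∃ k : ℤ, x * r = (s * t) ^ k ∨ x * r = (s * t) ^ k * s := by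
    rintro x r (rfl | rfl) ⟨k, rfl | rfl⟩
    · exact ⟨k, Or.inr rfl⟩
    · exact ⟨k, Or.inl (mul_mul_self_of_mem_range hs _)⟩
    · exact ⟨k - 1, Or.inr (hm k)⟩
    · refine ⟨k + 1, Or.inl ?_⟩
      rw [zpow_add_one, mul_assoc]
  have hr : ∀ r ∈ ({s, t} : Set W), r⁻¹ = r := by
    rintro _ (rfl | rfl)
    exacts [inv_of_mem_range hs, inv_of_mem_range ht]
  have : ∃ k : ℤ, w = (s * t) ^ k ∨ w = (s * t) ^ k * s := by
    induction hw using Subgroup.closure_induction_right with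
    | one => exact ⟨0, by simp⟩
    | mul_right x _ y hy ih => exact step x y hy ih
    | mul_inv_cancel x _ y hy ih =>
      rw [hr y hy]
      exact step x y hy ih
  obtain ⟨k, rfl | rfl⟩ := this
  · exact Or.inl ⟨k, rfl⟩
  · exact Or.inr ⟨_, ⟨k, rfl⟩, rfl⟩

theorem two_le_ord (hs : Desc cs x s) (ht : Desc cs x t) (hst : s ≠ t) : 2 ≤ ord s t := by
  have hfin := finite_closure_of_desc (desc_of_mem_pair hs ht)
  have hpos : 0 < ord s t := by
    rw [ord, orderOf_pos_iff]
    have := hfin.to_subtype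
    have := isOfFinOrder_of_finite (G := Subgroup.closure {s, t})
      ⟨s * t, mul_mem (Subgroup.subset_closure (by simp)) (Subgroup.subset_closure (by simp))⟩
    exact Submonoid.isOfFinOrder_coe.2 this
  have hne : ord s t ≠ 1 := by
    rw [ord, Ne, orderOf_eq_one_iff]
    intro h
    exact hst (by rw [eq_inv_of_mul_eq_one_left h, inv_of_mem_range ht.1])
  omega

theorem Desc.mul (hs : Desc cs x s) (ht : Desc cs x t) (hst : s ≠ t) : Desc cs (x * s) t := by
  have h2 := length_mul_altProd hs ht (two_le_ord hs ht hst)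
  have := hs.length
  simp only [altProd, mul_one, ← mul_assoc] at h2
  exact ⟨ht.1, by omega⟩

theorem Desc.mul_two (hs : Desc cs x s) (ht : Desc cs x t) (h : 3 ≤ ord s t) :
    Desc cs (x * s * t) s := by
  have h2 := length_mul_altProd hs ht h
  have h1 := length_mul_altProd hs ht (show 2 ≤ ord s t by omega)
  simp only [altProd, mul_one, ← mul_assoc] at h1 h2
  exact ⟨hs.1, by omega⟩

theorem Desc.mul_three (hs : Desc cs x s) (ht : Desc cs x t) (h : 4 ≤ ord s t) :
    Desc cs (x * s * t * s) t := by
  have h2 := length_mul_altProd hs ht h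
  have h1 := length_mul_altProd hs ht (show 3 ≤ ord s t by omega)
  simp only [altProd, mul_one, ← mul_assoc] at h1 h2
  exact ⟨ht.1, by omega⟩

theorem Desc.mul_four (hs : Desc cs x s) (ht : Desc cs x t) (h : 5 ≤ ord s t) :
    Desc cs (x * s * t * s * t) s := by
  have h2 := length_mul_altProd hs ht h
  have h1 := length_mul_altProd hs ht (show 4 ≤ ord s t by omega)
  simp only [altProd, mul_one, ← mul_assoc] at h1 h2
  exact ⟨hs.1, by omega⟩

theorem Desc.mul_five (hs : Desc cs x s) (ht : Desc cs x t) (h : 6 ≤ ord s t) :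
    Desc cs (x * s * t * s * t * s) t := by
  have h2 := length_mul_altProd hs ht h
  have h1 := length_mul_altProd hs ht (show 5 ≤ ord s t by omega)
  simp only [altProd, mul_one, ← mul_assoc] at h1 h2
  exact ⟨ht.1, by omega⟩

theorem mul_comm_of_ord_eq_two (hs : s ∈ Set.range cs.simple) (ht : t ∈ Set.range cs.simple)
    (h : ord s t = 2) : s * t = t * s := by
  have := pow_orderOf_eq_one (s * t)
  rw [← ord, h, ← altProd_mul_inv hs ht, mul_inv_eq_one] at this
  simpa [altProd] using this

theorem braid_of_ord_eq_three (hs : s ∈ Set.range cs.simple) (ht : t ∈ Set.range cs.simple)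
    (h : ord s t = 3) : s * t * s = t * s * t := by
  have := pow_orderOf_eq_one (s * t)
  rw [← ord, h, ← altProd_mul_inv hs ht, mul_inv_eq_one] at this
  simpa [altProd, mul_assoc] using this

theorem desc_mul_iff_of_ord_eq_two (hs : s ∈ Set.range cs.simple) (ht : t ∈ Set.range cs.simple)
    (h : ord s t = 2) : Desc cs (x * t) s ↔ Desc cs x s := by
  have hst : s ≠ t := by
    rintro rfl
    rw [ord, mul_self_of_mem_range hs, orderOf_one] at h
    omega
  have key : ∀ x, Desc cs x s → Desc cs (x * t) s := by
    intro x hx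
    by_cases hd : Desc cs x t
    · exact hd.mul hx hst.symm
    · by_contra hn
      have h1 := length_mul_of_not_desc hs hn
      have h2 := length_mul_of_not_desc ht hd
      have h3 := hx.length
      have h4 := length_mul_of_mem_range ht (x * s)
      rw [mul_assoc, mul_comm_of_ord_eq_two hs ht h, ← mul_assoc] at h4
      omega
  refine ⟨fun hx ↦ ?_, key x⟩
  simpa [mul_mul_self_of_mem_range ht] using key _ hx

end Dihedral

section RankThree

theorem exists_finite_invariant_of_braid_three {X : Type*} {c d f : X → X} {q : X}
    (hcc : ∀ x, c (c x) = x) (hdd : ∀ x, d (d x) = x) (hff : ∀ x, f (f x) = x)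
    (hcf : ∀ x, c (f x) = f (c x)) (hdf : ∀ x, d (f (d x)) = f (d (f x)))
    (hcd : ∀ x, c (d (c x)) = d (c (d x))) (hc : c q = q) (hd : d q = q) :
    ∃ Y : Set X, Y.Finite ∧ q ∈ Y ∧ ∀ y ∈ Y, c y ∈ Y ∧ d y ∈ Y ∧ f y ∈ Y := by
  set q₁ := f q with h₁
  set q₂ := d q₁ with h₂
  set q₃ := c q₂ with h₃
  have c₁ : c q₁ = q₁ := by grind
  have f₂ : f q₂ = q₂ := by grind
  have d₃ : d q₃ = q₃ := by grind
  have f₃ : f q₃ = q₃ := by grind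
  refine ⟨{q, q₁, q₂, q₃}, by simp, by simp, ?_⟩
  simp only [Set.mem_insert_iff, Set.mem_singleton_iff]
  rintro y (rfl | rfl | rfl | rfl) <;> grind

theorem exists_finite_invariant_of_braid_four {X : Type*} {c d f : X → X} {q : X}
    (hcc : ∀ x, c (c x) = x) (hdd : ∀ x, d (d x) = x) (hff : ∀ x, f (f x) = x)
    (hcf : ∀ x, c (f x) = f (c x)) (hdf : ∀ x, d (f (d x)) = f (d (f x)))
    (hcd : ∀ x, c (d (c (d x))) = d (c (d (c x)))) (hc : c q = q) (hd : d q = q) :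
    ∃ Y : Set X, Y.Finite ∧ q ∈ Y ∧ ∀ y ∈ Y, c y ∈ Y ∧ d y ∈ Y ∧ f y ∈ Y := by
  set q₁ := f q with h₁
  set q₂ := d q₁ with h₂
  set q₃ := c q₂ with h₃
  set q₄ := d q₃ with h₄
  set q₅ := f q₄ with h₅
  have c₁ : c q₁ = q₁ := by grind
  have f₂ : f q₂ = q₂ := by grind
  have f₃ : f q₃ = q₃ := by grind
  have c₄ : c q₄ = q₄ := by grind
  have c₅ : c q₅ = q₅ := by grind
  have d₅ : d q₅ = q₅ := by grind
  refine ⟨{q, q₁, q₂, q₃, q₄, q₅}, by simp, by simp, ?_⟩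
  simp only [Set.mem_insert_iff, Set.mem_singleton_iff]
  rintro y (rfl | rfl | rfl | rfl | rfl | rfl) <;> grind

theorem exists_finite_invariant_of_braid_five {X : Type*} {c d f : X → X} {q : X}
    (hcc : ∀ x, c (c x) = x) (hdd : ∀ x, d (d x) = x) (hff : ∀ x, f (f x) = x)
    (hcf : ∀ x, c (f x) = f (c x)) (hdf : ∀ x, d (f (d x)) = f (d (f x)))
    (hcd : ∀ x, c (d (c (d (c x)))) = d (c (d (c (d x))))) (hc : c q = q) (hd : d q = q) :
    ∃ Y : Set X, Y.Finite ∧ q ∈ Y ∧ ∀ y ∈ Y, c y ∈ Y ∧ d y ∈ Y ∧ f y ∈ Y := by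
  set q₁ := f q with h₁
  set q₂ := d q₁ with h₂
  set q₃ := c q₂ with h₃
  set q₄ := d q₃ with h₄
  set q₅ := c q₄ with h₅
  set q₆ := f q₄ with h₆
  set q₇ := f q₅ with h₇
  set q₈ := d q₇ with h₈
  set q₉ := c q₈ with h₉
  set q₁₀ := d q₉ with h₁₀
  set q₁₁ := f q₁₀ with h₁₁
  have c₁ : c q₁ = q₁ := by grind
  have f₂ : f q₂ = q₂ := by grind
  have f₃ : f q₃ = q₃ := by grind
  have d₅ : d q₅ = q₅ := by rw [h₅, h₄, h₃, h₂, ← hcd, c₁]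
  have d₆ : d q₆ = q₆ := by grind
  have c₆ : c q₆ = q₇ := by grind
  have f₈ : f q₈ = q₈ := by grind
  have f₉ : f q₉ = q₉ := by grind
  have c₁₀ : c q₁₀ = q₁₀ := by
    rw [h₁₀, h₉, h₈, ← c₆, hcd, d₆]
  have c₁₁ : c q₁₁ = q₁₁ := by grind
  have d₁₁ : d q₁₁ = q₁₁ := by grind
  refine ⟨{q, q₁, q₂, q₃, q₄, q₅, q₆, q₇, q₈, q₉, q₁₀, q₁₁}, by simp, by simp, ?_⟩
  have cq₇ : c q₇ = q₆ := by rw [← c₆, hcc]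
  have e₁ : d q₂ = q₁ := hdd _
  have e₂ : c q₃ = q₂ := hcc _
  have e₃ : d q₄ = q₃ := hdd _
  have e₄ : c q₅ = q₄ := hcc _
  have e₅ : f q₆ = q₄ := hff _
  have e₆ : f q₇ = q₅ := hff _
  have e₇ : d q₈ = q₇ := hdd _
  have e₈ : c q₉ = q₈ := hcc _
  have e₉ : d q₁₀ = q₉ := hdd _
  have e₁₀ : f q₁₁ = q₁₀ := hff _
  have e₁₁ : f q₁ = q := hff _
  clear_value q₁₁ q₁₀ q₉ q₈ q₇ q₆ q₅ q₄ q₃ q₂ q₁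
  clear hcc hdd hff hcf hdf hcd
  simp only [Set.mem_insert_iff, Set.mem_singleton_iff]
  rintro y (h | h | h | h | h | h | h | h | h | h | h | h) <;> rw [h] <;> grind

theorem finite_closure_of_finite_invariant {H : Subgroup W} (hH : (H : Set W).Finite)
    {J : Set W} (hJ : ∀ s ∈ J, s⁻¹ = s) {Y : Set (W ⧸ H)} (hY : Y.Finite)
    (h1 : ((1 : W) : W ⧸ H) ∈ Y) (hinv : ∀ s ∈ J, ∀ y ∈ Y, s • y ∈ Y) :
    (Subgroup.closure J : Set W).Finite := by
  have hsub : (Subgroup.closure J : Set W) ⊆ (fun w : W ↦ (w : W ⧸ H)) ⁻¹' Y := by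
    intro w hw
    change (w : W ⧸ H) ∈ Y
    induction hw using Subgroup.closure_induction_left with
    | one => exact h1
    | mul_left x hx y _ ih => exact hinv x hx _ ih
    | inv_mul_cancel x hx y _ ih => rw [hJ x hx]; exact hinv x hx _ ih
  refine (hY.preimage' fun b _ ↦ ?_).subset hsub
  obtain ⟨x, rfl⟩ := QuotientGroup.mk_surjective b
  refine (hH.image (x * ·)).subset fun w hw ↦ ⟨x⁻¹ * w, ?_, by simp⟩
  exact QuotientGroup.eq.1 (Eq.symm hw)

variable {cs : CoxeterSystem M W} {c d f : W}

theorem altProd_eq_of_ord_eq (hc : c ∈ Set.range cs.simple) (hd : d ∈ Set.range cs.simple) {n : ℕ}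
    (h : ord c d = n) : altProd c d n = altProd d c n := by
  have := pow_orderOf_eq_one (c * d)
  rwa [← ord, h, ← altProd_mul_inv hc hd, mul_inv_eq_one] at this

theorem TwoDimensional.not_exists_finite_invariant (h2 : TwoDimensional cs)
    (hc : c ∈ Set.range cs.simple) (hd : d ∈ Set.range cs.simple) (hf : f ∈ Set.range cs.simple)
    (hcd : c ≠ d) (hcf : c ≠ f) (hdf : d ≠ f) (h0 : ord c d ≠ 0) :
    ¬ ∃ Y : Set (W ⧸ Subgroup.closure {c, d}), Y.Finite ∧
      ((1 : W) : W ⧸ Subgroup.closure {c, d}) ∈ Y ∧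
      ∀ y ∈ Y, c • y ∈ Y ∧ d • y ∈ Y ∧ f • y ∈ Y := by
  rintro ⟨Y, hY, h1, hinv⟩
  refine h2.not_finite hc hd hf hcd hcf hdf (finite_closure_of_finite_invariant
    (finite_closure_pair_of_ord_ne_zero hc hd h0) ?_ hY h1 ?_)
  · rintro _ (rfl | rfl | rfl)
    exacts [inv_of_mem_range hc, inv_of_mem_range hd, inv_of_mem_range hf]
  · rintro _ (rfl | rfl | rfl) y hy
    exacts [(hinv y hy).1, (hinv y hy).2.1, (hinv y hy).2.2]

theorem TwoDimensional.ord_eq_zero_of_commute (h2 : TwoDimensional cs)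
    (hc : c ∈ Set.range cs.simple) (hd : d ∈ Set.range cs.simple) (hf : f ∈ Set.range cs.simple)
    (hcd : c ≠ d) (hcf : c ≠ f) (hdf : d ≠ f) (hmc : ord f c = 2) (hmd : ord f d = 2) :
    ord c d = 0 := by
  by_contra h0
  have hc1 : c • ((1 : W) : W ⧸ Subgroup.closure {c, d}) =
      ((1 : W) : W ⧸ Subgroup.closure {c, d}) :=
    QuotientGroup.eq.2 (by simpa using Subgroup.subset_closure (by simp))
  have hd1 : d • ((1 : W) : W ⧸ Subgroup.closure {c, d}) =
      ((1 : W) : W ⧸ Subgroup.closure {c, d}) :=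
    QuotientGroup.eq.2 (by simpa using Subgroup.subset_closure (by simp))
  refine h2.not_exists_finite_invariant hc hd hf hcd hcf hdf h0
    ⟨{((1 : W) : W ⧸ Subgroup.closure {c, d}), f • ((1 : W) : W ⧸ Subgroup.closure {c, d})},
      by simp, by simp, ?_⟩
  rintro _ (rfl | rfl)
  · simp [hc1, hd1]
  · simp only [← mul_smul]
    rw [← mul_comm_of_ord_eq_two hf hc hmc, ← mul_comm_of_ord_eq_two hf hd hmd,
      mul_self_of_mem_range hf, mul_smul, mul_smul, hc1, hd1]
    simp

theorem TwoDimensional.ord_eq_zero_or_six_le (h2 : TwoDimensional cs)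
    (hc : c ∈ Set.range cs.simple) (hd : d ∈ Set.range cs.simple) (hf : f ∈ Set.range cs.simple)
    (hcd : c ≠ d) (hcf : c ≠ f) (hdf : d ≠ f) (hmc : ord c f = 2) (hmd : ord d f = 3) :
    ord c d = 0 ∨ 6 ≤ ord c d := by
  by_contra! h
  obtain ⟨h0, h6⟩ := h
  have hc1 : c • ((1 : W) : W ⧸ Subgroup.closure {c, d}) =
      ((1 : W) : W ⧸ Subgroup.closure {c, d}) :=
    QuotientGroup.eq.2 (by simpa using Subgroup.subset_closure (by simp))
  have hd1 : d • ((1 : W) : W ⧸ Subgroup.closure {c, d}) =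
      ((1 : W) : W ⧸ Subgroup.closure {c, d}) :=
    QuotientGroup.eq.2 (by simpa using Subgroup.subset_closure (by simp))
  have hss : ∀ s ∈ Set.range cs.simple, ∀ x : W ⧸ Subgroup.closure {c, d}, s • s • x = x :=
    fun s hs x ↦ by rw [← mul_smul, mul_self_of_mem_range hs, one_smul]
  have hcf' : ∀ x : W ⧸ Subgroup.closure {c, d}, c • f • x = f • c • x := fun x ↦ by
    rw [← mul_smul, mul_comm_of_ord_eq_two hc hf hmc, mul_smul]
  have hdf' : ∀ x : W ⧸ Subgroup.closure {c, d}, d • f • d • x = f • d • f • x := fun x ↦ by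
    have := braid_of_ord_eq_three hd hf hmd
    simp only [← mul_smul, ← mul_assoc, this]
  have halt := altProd_eq_of_ord_eq hc hd rfl
  refine h2.not_exists_finite_invariant hc hd hf hcd hcf hdf h0 ?_
  have h3 : ord c d = 0 ∨ ord c d = 1 ∨ ord c d = 2 ∨ ord c d = 3 ∨ ord c d = 4 ∨ ord c d = 5 := by
    omega
  rcases h3 with h3 | h3 | h3 | h3 | h3 | h3
  · exact absurd h3 h0
  · rw [ord, orderOf_eq_one_iff] at h3
    exact absurd (by rw [eq_inv_of_mul_eq_one_left h3, inv_of_mem_range hd]) hcd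
  · have := h2.ord_eq_zero_of_commute hd hf hc hdf hcd.symm hcf.symm h3 hmc
    omega
  · rw [h3] at halt
    refine exists_finite_invariant_of_braid_three (c := (c • ·)) (d := (d • ·)) (f := (f • ·))
      (hss c hc) (hss d hd) (hss f hf) hcf' hdf' (fun x ↦ ?_) hc1 hd1
    simpa only [altProd, mul_one, mul_smul] using congrArg (· • x) halt
  · rw [h3] at halt
    refine exists_finite_invariant_of_braid_four (c := (c • ·)) (d := (d • ·)) (f := (f • ·))
      (hss c hc) (hss d hd) (hss f hf) hcf' hdf' (fun x ↦ ?_) hc1 hd1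
    simpa only [altProd, mul_one, mul_smul] using congrArg (· • x) halt
  · rw [h3] at halt
    refine exists_finite_invariant_of_braid_five (c := (c • ·)) (d := (d • ·)) (f := (f • ·))
      (hss c hc) (hss d hd) (hss f hf) hcf' hdf' (fun x ↦ ?_) hc1 hd1
    simpa only [altProd, mul_one, mul_smul] using congrArg (· • x) halt

end RankThree

section LocalDescents

variable {cs : CoxeterSystem M W} {x z a b c d f r s t p : W}

theorem ord_self (hs : s ∈ Set.range cs.simple) : ord s s = 1 := by
  rw [ord, mul_self_of_mem_range hs, orderOf_one]

theorem ne_of_two_le_ord (hs : s ∈ Set.range cs.simple) (h : 2 ≤ ord s t) : s ≠ t := by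
  rintro rfl
  rw [ord_self hs] at h
  omega

theorem Desc.ne_of_mul (ha : Desc cs x a) (hb : Desc cs (x * a) b) : a ≠ b := by
  rintro rfl
  exact ha.not_desc_mul hb

/-- If `a`, `r` are descents of `x` and pairwise orders are at least three, then `x * a` has no
further descent. -/
theorem not_desc_mul_of_three_le (ha : Desc cs x a) (hr : Desc cs x r) (har : 3 ≤ ord a r)
    (hab : 3 ≤ ord a b) (hbr : 3 ≤ ord b r) : ¬ Desc cs (x * a) b := by
  intro hb
  induction hn : cs.length x using Nat.strong_induction_on generalizing x a b r with
  | _ n ih =>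
    have := ha.length
    exact ih _ (by omega) (ha.mul hr (ne_of_two_le_ord ha.1 (by omega))) hb
      (by rwa [ord_comm]) (by rwa [ord_comm]) hab (ha.mul_two hr har) rfl

theorem not_desc_mul_of_four_le (hcf : ord c f = 2) (hdf : 4 ≤ ord d f) (hcd : 4 ≤ ord c d)
    (hd : Desc cs z d) (hf : Desc cs z f) : ¬ Desc cs (z * d) c := by
  intro hc
  induction hn : cs.length z using Nat.strong_induction_on generalizing z with
  | _ n ih =>
    have hfc : ord f c = 2 := by rwa [ord_comm]
    have hdc : 4 ≤ ord d c := by rwa [ord_comm]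
    have hzf : Desc cs (z * d) f := hd.mul hf (ne_of_two_le_ord hd.1 (by omega))
    have hwd : Desc cs (z * d * f) d := hd.mul_two hf (by omega)
    have hwc : Desc cs (z * d * f) c := (desc_mul_iff_of_ord_eq_two hc.1 hf.1 hcf).2 hc
    have hwdc : Desc cs (z * d * f * d) c := hwd.mul hwc (ne_of_two_le_ord hd.1 (by omega))
    have hlen : cs.length (z * d * f * d * c) < n := by
      have := hd.length
      have := hzf.length
      have := hwd.length
      have := hwdc.length
      omega
    exact ih _ hlen (hwd.mul_two hwc (by omega))
      ((desc_mul_iff_of_ord_eq_two hf.1 hc.1 hfc).2 (hd.mul_three hf hdf))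
      (hwd.mul_three hwc hdc) rfl

theorem not_desc_mul_mul_of_six_le (hcf : ord c f = 2) (hdf : 3 ≤ ord d f) (hcd : 6 ≤ ord c d)
    (hd : Desc cs z d) (hf : Desc cs z f) (hc : Desc cs (z * d) c) :
    ¬ Desc cs (z * d * c) d := by
  intro hdcd
  induction hn : cs.length z using Nat.strong_induction_on generalizing z with
  | _ n ih =>
    have hfc : ord f c = 2 := by rwa [ord_comm]
    have hzf : Desc cs (z * d) f := hd.mul hf (ne_of_two_le_ord hd.1 (by omega))
    have hwd : Desc cs (z * d * f) d := hd.mul_two hf hdf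
    have hwc : Desc cs (z * d * f) c := (desc_mul_iff_of_ord_eq_two hc.1 hf.1 hcf).2 hc
    have hwcd : Desc cs (z * d * f * c) d := hwc.mul hwd (ne_of_two_le_ord hc.1 (by omega))
    have hwcdc : Desc cs (z * d * f * c * d) c := hwc.mul_two hwd (by omega)
    have hzcf : Desc cs (z * d * c) f := (desc_mul_iff_of_ord_eq_two hf.1 hc.1 hfc).2 hzf
    have hwcdf : Desc cs (z * d * f * c * d) f := by
      have := hzcf.mul_two hdcd (by rwa [ord_comm])
      rwa [mul_assoc (z * d), mul_comm_of_ord_eq_two hc.1 hf.1 hcf, ← mul_assoc] at this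
    have hlen : cs.length (z * d * f * c * d * c) < n := by
      have := hd.length
      have := hzf.length
      have := hwc.length
      have := hwcd.length
      have := hwcdc.length
      omega
    exact ih _ hlen (hwc.mul_three hwd (by omega))
      ((desc_mul_iff_of_ord_eq_two hf.1 hc.1 hfc).2 hwcdf) (hwc.mul_four hwd (by omega))
      (hwc.mul_five hwd hcd) rfl

theorem TwoDimensional.ord_of_desc_of_three_le (h2 : TwoDimensional cs) (ha : Desc cs x a)
    (hr : Desc cs x r) (hb : Desc cs (x * a) b) (hbr : b ≠ r) (har : 3 ≤ ord a r)
    (hab : 3 ≤ ord a b) : ord a r = 3 ∧ ord b r = 2 ∧ 6 ≤ ord a b := by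
  have har' := ne_of_two_le_ord ha.1 (show 2 ≤ ord a r by omega)
  have hab' := ne_of_two_le_ord ha.1 (show 2 ≤ ord a b by omega)
  have hxr := ha.mul hr har'
  have hbr2 : ord b r = 2 := by
    have := two_le_ord hb hxr hbr
    have : ¬ 3 ≤ ord b r := fun h ↦ not_desc_mul_of_three_le ha hr har hab h hb
    omega
  have hrb2 : ord r b = 2 := by rwa [ord_comm]
  have har3 : ord a r = 3 := by
    by_contra hne
    by_cases h4 : 4 ≤ ord a b
    · exact not_desc_mul_of_four_le hbr2 (by omega) (by rwa [ord_comm]) ha hr hb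
    · have h6 := h2.ord_eq_zero_or_six_le hr.1 ha.1 hb.1 har'.symm hbr.symm hab' hrb2 (by omega)
      rw [ord_comm] at h6
      exact not_desc_mul_mul_of_six_le hrb2 hab (by rw [ord_comm]; omega) (ha.mul_two hr har)
        (hxr.mul hb hbr.symm) (ha.mul_three hr (by omega)) (ha.mul_four hr (by omega))
  refine ⟨har3, hbr2, ?_⟩
  have h6 := h2.ord_eq_zero_or_six_le hb.1 ha.1 hr.1 hab'.symm hbr har' hbr2 har3
  rw [ord_comm] at h6
  omega

/-- The orders forced by adjacent elements with two descents each. -/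
theorem TwoDimensional.ord_of_desc (h2 : TwoDimensional cs) (ha : Desc cs x a)
    (hr : Desc cs x r) (hb : Desc cs (x * a) b) (har : a ≠ r) (hbr : b ≠ r) :
    ord a r = 2 ∨ ord a r = 3 ∧ ord b r = 2 ∧ 6 ≤ ord a b := by
  have h := two_le_ord ha hr har
  rcases Nat.eq_or_lt_of_le h with h | har3
  · exact Or.inl h.symm
  right
  have hxr := ha.mul hr har
  have hxra := ha.mul_two hr har3
  have hxrb := hxr.mul hb hbr.symm
  have hab := ha.ne_of_mul hb
  have hab2 := two_le_ord hxra hxrb hab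
  rcases Nat.eq_or_lt_of_le hab2 with hab2 | hab3
  · exfalso
    have hba2 : ord b a = 2 := by rw [ord_comm]; exact hab2.symm
    have hrb3 : 3 ≤ ord r b := by
      have := two_le_ord hxr hb hbr.symm
      by_contra h
      have h0 := h2.ord_eq_zero_of_commute ha.1 hr.1 hb.1 har hab hbr.symm hba2
        (by rw [ord_comm]; omega)
      omega
    obtain ⟨_, _, h6⟩ := h2.ord_of_desc_of_three_le hxr hb hxra hab hrb3 (by rwa [ord_comm])
    rw [ord_comm] at h6
    exact not_desc_mul_mul_of_six_le hab2.symm hrb3 h6 hxr hb hxra (ha.mul_three hr (by omega))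
  · exact h2.ord_of_desc_of_three_le ha hr hb hbr har3 hab3

theorem TwoDimensional.not_desc_mul_of_ord_eq_three (h2 : TwoDimensional cs) (hst : ord s t = 2)
    (hs : Desc cs p s) (ht : Desc cs p t) (hsb : Desc cs (p * s) b) (hsb3 : 3 ≤ ord s b)
    (htb : ord t b = 3) : ¬ Desc cs (p * t) b := by
  intro htb'
  have hst' := ne_of_two_le_ord hs.1 (show 2 ≤ ord s t by omega)
  have hsb' := hs.ne_of_mul hsb
  have htbne := ht.ne_of_mul htb'
  have hts : ord t s = 2 := by rwa [ord_comm]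
  have hpts := ht.mul hs hst'.symm
  have hpst := hs.mul ht hst'
  have h6 := h2.ord_eq_zero_or_six_le hs.1 hsb.1 ht.1 hsb' hst' htbne.symm hst (by rwa [ord_comm])
  have hcomm : p * s * t = p * t * s := by
    rw [mul_assoc, mul_comm_of_ord_eq_two hs.1 ht.1 hst, mul_assoc]
  have h1 : Desc cs (p * t * s * b) t := by
    rw [← hcomm]
    exact hpst.mul_two hsb (by omega)
  exact not_desc_mul_mul_of_six_le hst (by rw [ord_comm]; omega) (by omega)
    (hpts.mul_three htb' (by omega)) ((desc_mul_iff_of_ord_eq_two ht.1 hs.1 hts).2 h1)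
    (hpts.mul_four htb' (by omega)) (hpts.mul_five htb' (by omega))

theorem TwoDimensional.not_desc_mul_of_ord_eq_two (h2 : TwoDimensional cs) (hst : ord s t = 2)
    (hs : Desc cs p s) (ht : Desc cs p t) (hsb : Desc cs (p * s) b) : ¬ Desc cs (p * t) b := by
  intro htb
  induction hn : cs.length p using Nat.strong_induction_on generalizing p with
  | _ n ih =>
    have hst' := ne_of_two_le_ord hs.1 (show 2 ≤ ord s t by omega)
    have hsbne := hs.ne_of_mul hsb
    have htbne := ht.ne_of_mul htb
    have hts : ord t s = 2 := by rwa [ord_comm]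
    have hpts := ht.mul hs hst'.symm
    have hpst := hs.mul ht hst'
    have htb2 := two_le_ord hpst hsb htbne
    have hsb2 := two_le_ord hpts htb hsbne
    have hsb3 : 3 ≤ ord s b := by
      by_contra h
      have := h2.ord_eq_zero_of_commute ht.1 hsb.1 hs.1 htbne hst'.symm hsbne.symm hst (by omega)
      omega
    have htb3 : 3 ≤ ord t b := by
      by_contra h
      have := h2.ord_eq_zero_of_commute hs.1 hsb.1 ht.1 hsbne hst' htbne.symm hts (by omega)
      omega
    rcases Nat.eq_or_lt_of_le htb3 with h | htb4
    · exact h2.not_desc_mul_of_ord_eq_three hst hs ht hsb hsb3 h.symm htb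
    rcases Nat.eq_or_lt_of_le hsb3 with h | hsb4
    · exact h2.not_desc_mul_of_ord_eq_three hts ht hs htb htb3 h.symm hsb
    have hcomm : p * t * s = p * s * t := by
      rw [mul_assoc, mul_comm_of_ord_eq_two ht.1 hs.1 hts, mul_assoc]
    have h1 := hpts.mul_two htb hsb3
    have h3 := hpts.mul_three htb hsb4
    have hq := hpst.mul hsb htbne
    rw [hcomm] at h1 h3
    have hlen : cs.length (p * s * t * b) < n := by
      have := hs.length
      have := hpst.length
      have := hq.length
      omega
    exact ih _ hlen h1 (hpst.mul_two hsb htb3) h3 (hpst.mul_three hsb htb4) rfl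

end LocalDescents

section PiMap

variable {cs : CoxeterSystem M W} {x y a f s w : W}

theorem simple_image_descentSet (x : W) : cs.simple '' descentSet cs x = {s | Desc cs x s} := by
  ext s
  constructor
  · rintro ⟨i, hi, rfl⟩
    exact ⟨⟨i, rfl⟩, hi⟩
  · rintro ⟨⟨i, rfl⟩, hi⟩
    exact ⟨i, hi, rfl⟩

theorem descSubgroup_eq (x : W) : descSubgroup cs x = Subgroup.closure {s | Desc cs x s} := by
  rw [descSubgroup, simple_image_descentSet]

theorem finite_descSubgroup (x : W) : (descSubgroup cs x : Set W).Finite := by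
  rw [descSubgroup_eq]
  exact finite_closure_of_desc fun s hs ↦ hs

theorem wg_mem_and_length_le (x : W) : wg cs x ∈ descSubgroup cs x ∧
    ∀ w ∈ descSubgroup cs x, cs.length w ≤ cs.length (wg cs x) := by
  have h : ∃ w₀ ∈ descSubgroup cs x, ∀ w ∈ descSubgroup cs x, cs.length w ≤ cs.length w₀ :=
    Set.exists_max_image _ cs.length (finite_descSubgroup x) ⟨1, one_mem _⟩
  rw [wg, dif_pos h]
  exact h.choose_spec

theorem wg_mem_closure (x : W) : wg cs x ∈ Subgroup.closure {s | Desc cs x s} := by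
  rw [← descSubgroup_eq]
  exact (wg_mem_and_length_le x).1

theorem length_PiMap (x : W) :
    cs.length (PiMap cs x) + cs.length (wg cs x) = cs.length x :=
  length_mul_add_length_of_desc (fun _ hs ↦ hs) (wg_mem_closure x)

theorem not_desc_of_length_add_eq (hw : w ∈ Subgroup.closure {s | Desc cs x s})
    (hl : cs.length w = cs.length (wg cs x)) (hs : Desc cs x s) : ¬ Desc cs (x * w) s := by
  intro h
  have hws := mul_mem hw (Subgroup.subset_closure hs)
  have h1 := length_mul_add_length_of_desc (fun _ hs ↦ hs) hw
  have h2 := length_mul_add_length_of_desc (fun _ hs ↦ hs) hws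
  have h3 := (wg_mem_and_length_le (cs := cs) x).2 (w * s) (by rwa [descSubgroup_eq])
  have h4 := h.length
  rw [← mul_assoc] at h2
  omega

theorem PiMap_eq {J : Set W} (hJ : ∀ s, Desc cs x s ↔ s ∈ J)
    (hy : x⁻¹ * y ∈ Subgroup.closure J) (hyJ : ∀ s ∈ J, ¬ Desc cs y s) : PiMap cs x = y := by
  have hJ' : {s | Desc cs x s} = J := Set.ext hJ
  refine eq_of_not_desc (cs := cs) (u := x) (J := J) (fun s hs ↦ (hJ s).2 hs) ?_ hy ?_ hyJ
  · rw [← hJ', PiMap, inv_mul_cancel_left]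
    exact wg_mem_closure x
  · exact fun s hs ↦ not_desc_of_length_add_eq (wg_mem_closure x) rfl ((hJ s).2 hs)

theorem wg_inv (x : W) : (wg cs x)⁻¹ = wg cs x := by
  have : PiMap cs x = x * (wg cs x)⁻¹ := PiMap_eq (fun _ ↦ Iff.rfl)
    (by rw [inv_mul_cancel_left]; exact inv_mem (wg_mem_closure x))
    fun s hs ↦ not_desc_of_length_add_eq (inv_mem (wg_mem_closure x)) (cs.length_inv _) hs
  exact (mul_left_cancel this).symm

theorem exists_desc (h : x ≠ 1) : ∃ s, Desc cs x s := by
  obtain ⟨i, hi⟩ := cs.exists_rightDescent_of_ne_one h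
  exact ⟨cs.simple i, ⟨i, rfl⟩, hi⟩

theorem Desc.ne_one (h : Desc cs x s) : x ≠ 1 := by
  rintro rfl
  have := h.2
  simp at this

theorem length_PiMap_lt (h : x ≠ 1) : cs.length (PiMap cs x) < cs.length x := by
  obtain ⟨s, hs⟩ := exists_desc (cs := cs) h
  have h1 := (wg_mem_and_length_le (cs := cs) x).2 s
    (by rw [descSubgroup_eq]; exact Subgroup.subset_closure hs)
  rw [length_of_mem_range hs.1] at h1
  have := length_PiMap (cs := cs) x
  omega

theorem length_PiMap_le (x : W) : cs.length (PiMap cs x) ≤ cs.length x := by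
  have := length_PiMap (cs := cs) x
  omega

theorem length_iterate_PiMap_le (n : ℕ) (x : W) :
    cs.length ((PiMap cs)^[n] x) ≤ cs.length x := by
  induction n generalizing x with
  | zero => rfl
  | succ n ih => exact (ih _).trans (length_PiMap_le x)

theorem length_iterate_PiMap_lt (h : x ≠ 1) {n : ℕ} (hn : n ≠ 0) :
    cs.length ((PiMap cs)^[n] x) < cs.length x := by
  obtain ⟨n, rfl⟩ := Nat.exists_eq_succ_of_ne_zero hn
  exact (length_iterate_PiMap_le n _).trans_lt (length_PiMap_lt h)

theorem PiMap_one : PiMap cs (1 : W) = 1 := by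
  have := length_PiMap_le (cs := cs) (1 : W)
  rw [cs.length_one, Nat.le_zero, cs.length_eq_zero_iff] at this
  exact this

theorem PiMap_eq_of_forall_eq (ha : Desc cs x a) (h : ∀ r, Desc cs x r → r = a) :
    PiMap cs x = x * a := by
  refine PiMap_eq (J := {a}) (fun s ↦ ⟨h s, by rintro rfl; exact ha⟩)
    (by simp) ?_
  rintro _ rfl
  exact ha.not_desc_mul

theorem TwoDimensional.desc_iff_mem_pair (h2 : TwoDimensional cs) (ha : Desc cs x a)
    (hf : Desc cs x f) (haf : a ≠ f) (r : W) : Desc cs x r ↔ r ∈ ({a, f} : Set W) :=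
  ⟨fun h ↦ h2.eq_or_eq_of_desc ha hf haf h, fun h ↦ desc_of_mem_pair ha hf r h⟩

theorem TwoDimensional.PiMap_mem (h2 : TwoDimensional cs) (ha : Desc cs x a)
    (hf : Desc cs x f) (haf : a ≠ f) : x⁻¹ * PiMap cs x ∈ Subgroup.closure {a, f} := by
  have h : {s | Desc cs x s} = {a, f} := Set.ext (h2.desc_iff_mem_pair ha hf haf)
  rw [← h, PiMap, inv_mul_cancel_left]
  exact wg_mem_closure x

theorem TwoDimensional.PiMap_eq_of_ord_eq_two (h2 : TwoDimensional cs) (ha : Desc cs x a)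
    (hf : Desc cs x f) (h : ord a f = 2) : PiMap cs x = x * a * f := by
  have haf := ne_of_two_le_ord ha.1 h.ge
  refine PiMap_eq (h2.desc_iff_mem_pair ha hf haf) ?_ ?_
  · rw [mul_assoc, inv_mul_cancel_left]
    exact mul_mem (Subgroup.subset_closure (by simp)) (Subgroup.subset_closure (by simp))
  · rintro r (h' | h') <;> rw [h']
    · rw [mul_assoc, mul_comm_of_ord_eq_two ha.1 hf.1 h, ← mul_assoc]
      exact (hf.mul ha haf.symm).not_desc_mul
    · exact (ha.mul hf haf).not_desc_mul

theorem mul_braid_of_ord_eq_three (ha : a ∈ Set.range cs.simple) (hf : f ∈ Set.range cs.simple)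
    (h : ord a f = 3) (x : W) : x * a * f * a = x * f * a * f := by
  have := congrArg (x * ·) (braid_of_ord_eq_three ha hf h)
  simpa only [← mul_assoc] using this

theorem mul_comm_right_of_ord_eq_two (ha : a ∈ Set.range cs.simple)
    (hf : f ∈ Set.range cs.simple) (h : ord a f = 2) (x : W) : x * a * f = x * f * a := by
  rw [mul_assoc, mul_comm_of_ord_eq_two ha hf h, ← mul_assoc]

theorem TwoDimensional.PiMap_eq_of_ord_eq_three (h2 : TwoDimensional cs) (ha : Desc cs x a)
    (hf : Desc cs x f) (h : ord a f = 3) : PiMap cs x = x * a * f * a := by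
  have haf := ne_of_two_le_ord ha.1 (show 2 ≤ ord a f by omega)
  refine PiMap_eq (h2.desc_iff_mem_pair ha hf haf) ?_ ?_
  · rw [mul_assoc, mul_assoc, inv_mul_cancel_left]
    exact mul_mem (Subgroup.subset_closure (by simp))
      (mul_mem (Subgroup.subset_closure (by simp)) (Subgroup.subset_closure (by simp)))
  · rintro r (h' | h') <;> rw [h']
    · exact (ha.mul_two hf h.ge).not_desc_mul
    · rw [mul_braid_of_ord_eq_three ha.1 hf.1 h]
      exact (hf.mul_two ha (by rw [ord_comm, h])).not_desc_mul

end PiMap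

section Residue

variable {cs : CoxeterSystem M W} {x y f o s t : W}

/-- `x` and `y` lie in a common coset of a finite rank two standard parabolic subgroup. -/
def SameResidue (cs : CoxeterSystem M W) (x y : W) : Prop :=
  ∃ u a b, a ≠ b ∧ Desc cs u a ∧ Desc cs u b ∧ u⁻¹ * x ∈ Subgroup.closure {a, b} ∧
    u⁻¹ * y ∈ Subgroup.closure {a, b}

theorem SameResidue.symm (h : SameResidue cs x y) : SameResidue cs y x := by
  obtain ⟨u, a, b, hab, ha, hb, hx, hy⟩ := h
  exact ⟨u, a, b, hab, ha, hb, hy, hx⟩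

/-- Some iterates of `Π` at `x` and at `y`, of strictly smaller total length, lie in a common
finite rank two residue. -/
def Descends (cs : CoxeterSystem M W) (x y : W) : Prop :=
  ∃ m ≤ 3, ∃ n ≤ 3, SameResidue cs ((PiMap cs)^[m] x) ((PiMap cs)^[n] y) ∧
    cs.length ((PiMap cs)^[m] x) + cs.length ((PiMap cs)^[n] y) < cs.length x + cs.length y

theorem Descends.symm (h : Descends cs x y) : Descends cs y x := by
  obtain ⟨m, hm, n, hn, h, hl⟩ := h
  exact ⟨n, hn, m, hm, h.symm, by omega⟩

theorem Descends.of_sameResidue {m n : ℕ} (hx : x ≠ 1) (hm : m ≤ 3) (hn : n ≤ 3) (hm0 : m ≠ 0)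
    (h : SameResidue cs ((PiMap cs)^[m] x) ((PiMap cs)^[n] y)) : Descends cs x y :=
  ⟨m, hm, n, hn, h, add_lt_add_of_lt_of_le (length_iterate_PiMap_lt hx hm0)
    (length_iterate_PiMap_le n y)⟩

/-- `o` is the shortest element of the finite rank two residue `o * ⟨s, t⟩`. -/
structure IsBottom (cs : CoxeterSystem M W) (o s t : W) : Prop where
  exists_top : ∃ u, Desc cs u s ∧ Desc cs u t ∧ u⁻¹ * o ∈ Subgroup.closure {s, t}
  ne : s ≠ t
  not_desc_left : ¬ Desc cs o s
  not_desc_right : ¬ Desc cs o t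

namespace IsBottom

theorem symm (h : IsBottom cs o s t) : IsBottom cs o t s := by
  obtain ⟨u, hs, ht, hu⟩ := h.exists_top
  exact ⟨⟨u, ht, hs, by rwa [Set.pair_comm]⟩, h.ne.symm, h.not_desc_right, h.not_desc_left⟩

theorem left_mem (h : IsBottom cs o s t) : s ∈ Set.range cs.simple :=
  let ⟨_, hs, _, _⟩ := h.exists_top
  hs.1

theorem right_mem (h : IsBottom cs o s t) : t ∈ Set.range cs.simple := h.symm.left_mem

theorem two_le_ord (h : IsBottom cs o s t) : 2 ≤ ord s t :=
  let ⟨_, hs, ht, _⟩ := h.exists_top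
  CoxeterPaper.two_le_ord hs ht h.ne

theorem desc_left (h : IsBottom cs o s t) : Desc cs (o * s) s :=
  desc_mul_self_of_not_desc h.left_mem h.not_desc_left

theorem desc_right (h : IsBottom cs o s t) : Desc cs (o * t) t := h.symm.desc_left

theorem sameResidue (h : IsBottom cs o s t) (hx : o⁻¹ * x ∈ Subgroup.closure {s, t})
    (hy : o⁻¹ * y ∈ Subgroup.closure {s, t}) : SameResidue cs x y := by
  obtain ⟨u, hs, ht, hu⟩ := h.exists_top
  refine ⟨u, s, t, h.ne, hs, ht, ?_, ?_⟩
  · simpa [mul_assoc] using mul_mem hu hx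
  · simpa [mul_assoc] using mul_mem hu hy

theorem eq_of_not_desc (h : IsBottom cs o s t) (hx : o⁻¹ * x ∈ Subgroup.closure {s, t})
    (hs' : ¬ Desc cs x s) (ht' : ¬ Desc cs x t) : x = o := by
  obtain ⟨u, hs, ht, hu⟩ := h.exists_top
  refine CoxeterPaper.eq_of_not_desc (desc_of_mem_pair hs ht) ?_ hu ?_ ?_
  · simpa [mul_assoc] using mul_mem hu hx
  · rintro r (h' | h') <;> rw [h'] <;> assumption
  · rintro r (h' | h') <;> rw [h']
    exacts [h.not_desc_left, h.not_desc_right]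

end IsBottom

theorem SameResidue.exists_isBottom (h : SameResidue cs x y) :
    ∃ o s t, IsBottom cs o s t ∧ o⁻¹ * x ∈ Subgroup.closure {s, t} ∧
      o⁻¹ * y ∈ Subgroup.closure {s, t} := by
  obtain ⟨u, s, t, hst, hs, ht, hx, hy⟩ := h
  have hJ := desc_of_mem_pair hs ht
  obtain ⟨w, hw, hmax⟩ := Set.exists_max_image _ cs.length (finite_closure_of_desc hJ)
    ⟨1, one_mem _⟩
  have key : ∀ r ∈ ({s, t} : Set W), ¬ Desc cs (u * w) r := by
    intro r hr h
    have hwr := mul_mem hw (Subgroup.subset_closure hr)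
    have h1 := length_mul_add_length_of_desc hJ hw
    have h2 := length_mul_add_length_of_desc hJ hwr
    have h3 := hmax _ hwr
    have h4 := h.length
    rw [← mul_assoc] at h2
    omega
  refine ⟨u * w, s, t, ⟨⟨u, hs, ht, by simpa using hw⟩, hst, key s (by simp), key t (by simp)⟩,
    ?_, ?_⟩
  · simpa [mul_assoc] using mul_mem (inv_mem hw) hx
  · simpa [mul_assoc] using mul_mem (inv_mem hw) hy

/-- The elements `x` of the residue of `o` whose image under `Π` leaves the residue, with `f` the
descent of `x` outside of the residue. -/
inductive Leaves (cs : CoxeterSystem M W) (o s t f : W) : W → Prop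
  | one (h : Desc cs (o * s) f) : Leaves cs o s t f (o * s)
  | two (ht : Desc cs (o * s * t) t) (hf : Desc cs (o * s * t) f) (h : ord t f = 2) :
      Leaves cs o s t f (o * s * t)
  | three {x : W} (ht : Desc cs (o * s * t) t) (hf : Desc cs (o * s * t) f) (hsf : ord s f = 2)
      (htf : ord t f = 3) (hst : 6 ≤ ord s t) (hx : x = o * s * t ∨ x = o * s * t * s) :
      Leaves cs o s t f x

theorem TwoDimensional.leaves_of_desc (h2 : TwoDimensional cs) (ho : IsBottom cs o s t)
    (hx : o⁻¹ * x ∈ Subgroup.closure {s, t}) (hs : Desc cs x s) (hf : Desc cs x f) (hfs : f ≠ s)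
    (hft : f ≠ t) : Leaves cs o s t f x ∨ Leaves cs o t s f x := by
  have mem : ∀ {z r : W}, o⁻¹ * z ∈ Subgroup.closure {s, t} → r ∈ ({s, t} : Set W) →
      o⁻¹ * (z * r) ∈ Subgroup.closure {s, t} := fun hz hr ↦ by
    rw [← mul_assoc]
    exact mul_mem hz (Subgroup.subset_closure hr)
  have hst := ho.ne
  have h1 := mem hx (show s ∈ ({s, t} : Set W) by simp)
  have h1f : Desc cs (x * s) f := hs.mul hf hfs.symm
  by_cases h1t : Desc cs (x * s) t
  swap
  · have := ho.eq_of_not_desc h1 hs.not_desc_mul h1t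
    obtain rfl : x = o * s := by rw [← this, mul_mul_self_of_mem_range hs.1]
    exact .inl (.one hf)
  have adj := h2.ord_of_desc hs hf h1t hfs.symm hft.symm
  have h2' := mem h1 (show t ∈ ({s, t} : Set W) by simp)
  by_cases h2s : Desc cs (x * s * t) s
  swap
  · have := ho.eq_of_not_desc h2' h2s h1t.not_desc_mul
    obtain rfl : x = o * t * s := by
      rw [← this, mul_mul_self_of_mem_range h1t.1, mul_mul_self_of_mem_range hs.1]
    rcases adj with h | ⟨h, h', h''⟩
    · exact .inr (.two hs hf h)
    · exact .inr (.three hs hf h' h (by rwa [ord_comm]) (.inl rfl))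
  have adj' := h2.ord_of_desc h1t h1f h2s hft.symm hfs.symm
  rcases adj with hsf | ⟨hsf, htf, h6⟩
  · rcases adj' with htf | ⟨htf, -, h6⟩
    · have h0 := h2.ord_eq_zero_of_commute hs.1 h1t.1 hf.1 hst hfs.symm hft.symm
        (by rwa [ord_comm]) (by rwa [ord_comm])
      have := ho.two_le_ord
      omega
    · have h3 := mem h2' (show s ∈ ({s, t} : Set W) by simp)
      have := ho.eq_of_not_desc h3 h2s.not_desc_mul
        (not_desc_mul_mul_of_six_le hsf htf.ge (by rwa [ord_comm]) h1t h1f h2s)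
      obtain rfl : x = o * s * t * s := by
        rw [← this, mul_mul_self_of_mem_range h2s.1, mul_mul_self_of_mem_range h1t.1,
          mul_mul_self_of_mem_range hs.1]
      rw [mul_mul_self_of_mem_range hs.1] at h1t h1f
      exact .inl (.three h1t h1f hsf htf (by rwa [ord_comm]) (.inr rfl))
  · exact absurd h2s (not_desc_mul_mul_of_six_le htf hsf.ge (by rwa [ord_comm]) hs hf h1t)

theorem TwoDimensional.cases_of_mem_residue (h2 : TwoDimensional cs) (ho : IsBottom cs o s t)
    (hx : o⁻¹ * x ∈ Subgroup.closure {s, t}) :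
    x = o ∨ (x ≠ 1 ∧ o⁻¹ * PiMap cs x ∈ Subgroup.closure {s, t}) ∨
      ∃ f, f ≠ s ∧ f ≠ t ∧ (Leaves cs o s t f x ∨ Leaves cs o t s f x) := by
  by_cases h : ∃ f, Desc cs x f ∧ f ≠ s ∧ f ≠ t
  · obtain ⟨f, hf, hfs, hft⟩ := h
    by_cases hs : Desc cs x s
    · exact .inr (.inr ⟨f, hfs, hft, h2.leaves_of_desc ho hx hs hf hfs hft⟩)
    by_cases ht : Desc cs x t
    · rw [Set.pair_comm] at hx
      exact .inr (.inr ⟨f, hfs, hft, (h2.leaves_of_desc ho.symm hx ht hf hft hfs).symm⟩)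
    exact .inl (ho.eq_of_not_desc hx hs ht)
  · push Not at h
    by_cases hx1 : x = 1
    · refine .inl (ho.eq_of_not_desc hx ?_ ?_) <;> exact fun h ↦ h.ne_one hx1
    · refine .inr (.inl ⟨hx1, ?_⟩)
      rw [PiMap, ← mul_assoc]
      refine mul_mem hx (Subgroup.closure_mono ?_ (wg_mem_closure x))
      intro f hf
      by_cases hfs : f = s
      · simp [hfs]
      · simp [h f hf hfs]

end Residue

section Gate

variable {cs : CoxeterSystem M W} {x y z a b f o s t h : W}

theorem mul_mem_of_mem_pair (hx : o⁻¹ * x ∈ Subgroup.closure {s, t}) (hr : a = s ∨ a = t) :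
    o⁻¹ * (x * a) ∈ Subgroup.closure {s, t} := by
  rw [← mul_assoc]
  exact mul_mem hx (Subgroup.subset_closure hr)

/-- A residue `o * ⟨s, t⟩` that `Π` leaves at `o * s * t` and `o * s * t * s`. -/
structure IsGate (cs : CoxeterSystem M W) (o s t f : W) : Prop extends IsBottom cs o s t where
  desc : Desc cs (o * s * t) t
  desc' : Desc cs (o * s * t) f
  ord_left : ord s f = 2
  ord_right : ord t f = 3
  six_le : 6 ≤ ord s t

namespace IsGate

theorem ne_left (h : IsGate cs o s t f) : s ≠ f := ne_of_two_le_ord h.left_mem h.ord_left.ge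

theorem ne_right (h : IsGate cs o s t f) : t ≠ f :=
  ne_of_two_le_ord h.right_mem (by have := h.ord_right; omega)

theorem mem (h : IsGate cs o s t f) : f ∈ Set.range cs.simple := h.desc'.1

theorem desc_left' (h : IsGate cs o s t f) : Desc cs (o * s) f := by
  have := h.desc.mul h.desc' h.ne_right
  rwa [mul_mul_self_of_mem_range h.right_mem] at this

theorem desc_bot (h : IsGate cs o s t f) : Desc cs o f := by
  have := h.desc_left.mul h.desc_left' h.ne_left
  rwa [mul_mul_self_of_mem_range h.left_mem] at this

theorem desc_mul_right (h : IsGate cs o s t f) : Desc cs (o * s * f) t := by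
  have := h.desc.mul_two h.desc' h.ord_right.ge
  rwa [mul_mul_self_of_mem_range h.right_mem] at this

theorem desc_mul_left (h : IsGate cs o s t f) : Desc cs (o * s * f) s :=
  h.desc_left'.mul h.desc_left h.ne_left.symm

theorem mul_left (h : IsGate cs o s t f) : o * s * f * s = o * f := by
  rw [← mul_comm_right_of_ord_eq_two h.left_mem h.mem h.ord_left,
    mul_mul_self_of_mem_range h.left_mem]

theorem desc_bot_mul (h : IsGate cs o s t f) : Desc cs (o * f) t := by
  rw [← h.mul_left]
  exact h.desc_mul_left.mul h.desc_mul_right h.ne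

theorem eq_of_desc_bot (h2 : TwoDimensional cs) (h : IsGate cs o s t f) (hb : Desc cs o b) :
    b = f := by
  by_contra hbf
  have hbt : t ≠ b := fun e ↦ h.not_desc_right (e ▸ hb)
  have := h.desc_bot.mul hb (Ne.symm hbf)
  rw [← h.mul_left] at this
  have := h2.ord_of_desc h.desc_mul_left h.desc_mul_right this h.ne hbt.symm
  have := h.six_le
  omega

theorem not_desc_mul (h2 : TwoDimensional cs) (h : IsGate cs o s t f) :
    ¬ Desc cs (o * s * t) s := fun hs ↦ by
  rcases h2.eq_or_eq_of_desc h.desc h.desc' h.ne_right hs with e | e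
  exacts [h.ne e, h.ne_left e]

theorem desc_mul_left_mul_right_mul (h : IsGate cs o s t f) : Desc cs (o * s * f * t) s :=
  h.desc_mul_right.mul h.desc_mul_left h.ne.symm

theorem desc_bot_right (h : IsGate cs o s t f) : Desc cs (o * t) f := by
  by_contra hf
  have h1 := length_mul_of_not_desc h.mem hf
  have h2 := length_mul_of_not_desc h.right_mem h.not_desc_right
  have h3 := h.desc_bot.length
  have h4 := h.desc_bot_mul.length
  have h5 := length_mul_of_mem_range h.mem (o * f * t)
  have h6 := length_mul_of_mem_range h.right_mem (o * t * f)
  rw [mul_braid_of_ord_eq_three h.right_mem h.mem h.ord_right] at h6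
  omega

end IsGate

theorem TwoDimensional.iterate_three_PiMap_mul (h2 : TwoDimensional cs) (hsf : ord s f = 2)
    (htf : ord t f = 3) (ht : Desc cs y t) (hf : Desc cs y f) (hys : ¬ Desc cs y s)
    (hs : Desc cs (y * t * f * t) s) : (PiMap cs)^[3] (y * s) = y * t * f * t * s := by
  have hts : t ≠ s := fun e ↦ hys (e ▸ ht)
  have htf' : t ≠ f := ne_of_two_le_ord ht.1 (by omega)
  have hsf' : s ≠ f := ne_of_two_le_ord hs.1 hsf.ge
  have hyss := desc_mul_self_of_not_desc hs.1 hys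
  have hysf : Desc cs (y * s) f :=
    (desc_mul_iff_of_ord_eq_two hf.1 hs.1 (by rwa [ord_comm])).2 hf
  have e1 : PiMap cs (y * s) = y * f := by
    rw [h2.PiMap_eq_of_ord_eq_two hyss hysf hsf, mul_mul_self_of_mem_range hs.1]
  have hyft := hf.mul ht htf'.symm
  have hyftf : Desc cs (y * f * t) f := hf.mul_two ht (by rw [ord_comm, htf])
  have e3 : y * f * t * f = y * t * f * t := (mul_braid_of_ord_eq_three ht.1 hf.1 htf y).symm
  have hyfts : Desc cs (y * f * t) s := by
    rwa [← desc_mul_iff_of_ord_eq_two hs.1 hf.1 hsf, e3]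
  have e2 : PiMap cs (y * f) = y * f * t := by
    refine PiMap_eq_of_forall_eq hyft fun r hr ↦ ?_
    by_contra hrt
    have hr' := hyft.mul hr (Ne.symm hrt)
    rcases h2.eq_or_eq_of_desc hyfts hyftf hsf' hr' with rfl | rfl
    · exact hys ((desc_mul_iff_of_ord_eq_two hs.1 hf.1 hsf).1 hr)
    · exact hf.not_desc_mul hr
  have e4 : PiMap cs (y * f * t) = y * t * f * t * s := by
    rw [h2.PiMap_eq_of_ord_eq_two hyftf hyfts (by rwa [ord_comm]), e3]
  change PiMap cs (PiMap cs (PiMap cs (y * s))) = _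
  rw [e1, e2, e4]

/-- A few iterations of `Π` take every element near the bottom of a gate into the parallel
residue `o * s * f * ⟨s, t⟩`. -/
theorem IsGate.exists_iterate_PiMap_mem (h2 : TwoDimensional cs) (h : IsGate cs o s t f)
    (hz : (z = o ∨ z = o * s ∨ z = o * s * t ∨ z = o * s * t * s) ∨ z = o * t ∨ z = o * t * s) :
    ∃ m ≤ 3, m ≠ 0 ∧ z ≠ 1 ∧
      (o * s * f)⁻¹ * (PiMap cs)^[m] z ∈ Subgroup.closure {s, t} := by
  have base : (o * s * f)⁻¹ * (o * s * f) ∈ Subgroup.closure {s, t} := by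
    rw [inv_mul_cancel]
    exact one_mem _
  have hs0 : s = s ∨ s = t := .inl rfl
  have ht0 : t = s ∨ t = t := .inr rfl
  have hof := mul_mem_of_mem_pair base hs0
  have hoft := mul_mem_of_mem_pair hof ht0
  have hofts := mul_mem_of_mem_pair hoft hs0
  have hosft := mul_mem_of_mem_pair base ht0
  have hosfts := mul_mem_of_mem_pair hosft hs0
  rw [h.mul_left] at hof hoft hofts
  have hss := mul_mul_self_of_mem_range h.left_mem
  have htt := mul_mul_self_of_mem_range h.right_mem
  have hoft_s : Desc cs (o * f * t) s := by
    rw [← h.mul_left]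
    exact h.desc_mul_left.mul_two h.desc_mul_right (by have := h.six_le; omega)
  have hot_s : ¬ Desc cs (o * t) s := fun hs ↦ by
    rcases h2.eq_or_eq_of_desc h.desc_right h.desc_bot_right h.ne_right hs with e | e
    exacts [h.ne e, h.ne_left e]
  rcases hz with (rfl | rfl | rfl | rfl) | rfl | rfl
  · refine ⟨1, by simp, by simp, h.desc_bot.ne_one, ?_⟩
    rwa [Function.iterate_one, PiMap_eq_of_forall_eq h.desc_bot fun r ↦ h.eq_of_desc_bot h2]
  · refine ⟨1, by simp, by simp, h.desc_left.ne_one, ?_⟩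
    rwa [Function.iterate_one,
      h2.PiMap_eq_of_ord_eq_two h.desc_left h.desc_left' h.ord_left, hss]
  · refine ⟨1, by simp, by simp, h.desc.ne_one, ?_⟩
    rwa [Function.iterate_one, h2.PiMap_eq_of_ord_eq_three h.desc h.desc' h.ord_right, htt]
  · refine ⟨3, by simp, by simp, (desc_mul_self_of_not_desc h.left_mem (h.not_desc_mul h2)).ne_one,
      ?_⟩
    rw [h2.iterate_three_PiMap_mul h.ord_left h.ord_right h.desc h.desc' (h.not_desc_mul h2)
      (by rw [htt]; exact h.desc_mul_left_mul_right_mul), htt]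
    exact hosfts
  · refine ⟨1, by simp, by simp, h.desc_right.ne_one, ?_⟩
    rwa [Function.iterate_one,
      h2.PiMap_eq_of_ord_eq_three h.desc_right h.desc_bot_right h.ord_right, htt]
  · refine ⟨3, by simp, by simp, (desc_mul_self_of_not_desc h.left_mem hot_s).ne_one, ?_⟩
    rw [h2.iterate_three_PiMap_mul h.ord_left h.ord_right h.desc_right h.desc_bot_right hot_s
      (by rwa [htt]), htt]
    exact hofts

theorem IsGate.descends (h2 : TwoDimensional cs) (h : IsGate cs o s t f)
    (hx : (x = o ∨ x = o * s ∨ x = o * s * t ∨ x = o * s * t * s) ∨ x = o * t ∨ x = o * t * s)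
    (hy : (y = o ∨ y = o * s ∨ y = o * s * t ∨ y = o * s * t * s) ∨ y = o * t ∨ y = o * t * s) :
    Descends cs x y := by
  obtain ⟨m, hm, hm0, hx1, hxm⟩ := h.exists_iterate_PiMap_mem h2 hx
  obtain ⟨n, hn, -, -, hyn⟩ := h.exists_iterate_PiMap_mem h2 hy
  exact .of_sameResidue hx1 hm hn hm0 ⟨_, s, t, h.ne, h.desc_mul_left, h.desc_mul_right, hxm, hyn⟩

end Gate

section Descends

variable {cs : CoxeterSystem M W} {x f g o s t : W}

theorem IsBottom.desc_bot (ho : IsBottom cs o s t) (hf : Desc cs (o * s) f) (hfs : f ≠ s) :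
    Desc cs o f := by
  have := ho.desc_left.mul hf hfs.symm
  rwa [mul_mul_self_of_mem_range ho.left_mem] at this

theorem mem_closure_pair_left (s t : W) : s ∈ Subgroup.closure {s, t} :=
  Subgroup.subset_closure (by simp)

theorem mem_closure_pair_right (s t : W) : t ∈ Subgroup.closure {s, t} :=
  Subgroup.subset_closure (by simp)

theorem TwoDimensional.descends_mul (h2 : TwoDimensional cs) (hs : Desc cs x s)
    (hf : Desc cs x f) (hfs : f ≠ s) : Descends cs x (x * s) :=
  .of_sameResidue (m := 1) (n := 0) hs.ne_one (by simp) (by simp) (by simp)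
    ⟨x, s, f, hfs.symm, hs, hf, h2.PiMap_mem hs hf hfs.symm,
      by simpa using mem_closure_pair_left s f⟩

theorem TwoDimensional.descends_mul_mul (h2 : TwoDimensional cs) (ht : Desc cs x t)
    (hf : Desc cs x f) (htf : ord t f = 2) (hs : Desc cs (x * t) s) (hfs : f ≠ s) :
    Descends cs x (x * t * s) := by
  refine .of_sameResidue (m := 1) (n := 0) ht.ne_one (by simp) (by simp) (by simp)
    ⟨x * t, s, f, hfs.symm, hs, ht.mul hf (ne_of_two_le_ord ht.1 htf.ge), ?_, ?_⟩
  · rw [Function.iterate_one, h2.PiMap_eq_of_ord_eq_two ht hf htf, inv_mul_cancel_left]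
    exact mem_closure_pair_right s f
  · rw [Function.iterate_zero, id, inv_mul_cancel_left]
    exact mem_closure_pair_left s f

/-- Distinct outer descents on the two sides of the bottom of a residue exclude commutation. -/
theorem TwoDimensional.ord_ne_two_of_isBottom (h2 : TwoDimensional cs) (ho : IsBottom cs o s t)
    (hf : Desc cs (o * s) f) (hg : Desc cs (o * t) g) (hfs : f ≠ s) (hft : f ≠ t) (hgt : g ≠ t)
    (hfg : f ≠ g) : ord t f ≠ 2 := fun htf ↦ by
  have hof := ho.desc_bot hf hfs
  have hog := ho.symm.desc_bot hg hgt
  have hst := ho.two_le_ord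
  have h1 := h2.ord_of_desc ho.desc_left hf
    (by rwa [mul_mul_self_of_mem_range ho.left_mem]) hfs.symm hfg.symm
  have h3 := h2.ord_of_desc ho.desc_right hg
    (by rwa [mul_mul_self_of_mem_range ho.right_mem]) hgt.symm hfg
  rcases h1 with h1 | ⟨-, h1, -⟩
  · have := h2.ord_eq_zero_of_commute ho.left_mem ho.right_mem hof.1 ho.ne hfs.symm hft.symm
      (by rwa [ord_comm]) (by rwa [ord_comm])
    omega
  · rcases h3 with h3 | ⟨-, -, h3⟩
    · have := h2.ord_eq_zero_of_commute hof.1 hog.1 ho.right_mem hfg hft hgt htf h3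
      rw [ord_comm] at this
      omega
    · omega

theorem TwoDimensional.not_ord_eq_two_and (h2 : TwoDimensional cs) (ho : IsBottom cs o s t)
    (hf : f ∈ Set.range cs.simple) (hfs : f ≠ s) (hft : f ≠ t) (hsf : ord s f = 2) :
    ord t f ≠ 2 := fun htf ↦ by
  have := h2.ord_eq_zero_of_commute ho.left_mem ho.right_mem hf ho.ne hfs.symm hft.symm
    (by rwa [ord_comm]) (by rwa [ord_comm])
  have := ho.two_le_ord
  omega

theorem TwoDimensional.descends_two_one (h2 : TwoDimensional cs) (ho : IsBottom cs o s t)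
    (ht : Desc cs (o * s * t) t) (hf : Desc cs (o * s * t) f) (htf : ord t f = 2)
    (hg : Desc cs (o * t) g) (hfs : f ≠ s) (hft : f ≠ t) (hgt : g ≠ t) :
    Descends cs (o * s * t) (o * t) := by
  have hosf : Desc cs (o * s) f := by
    have := ht.mul hf hft.symm
    rwa [mul_mul_self_of_mem_range ht.1] at this
  obtain rfl : f = g := by
    by_contra hfg
    exact h2.ord_ne_two_of_isBottom ho hosf hg hfs hft hgt hfg htf
  have hss := mul_mul_self_of_mem_range ho.left_mem o
  refine .of_sameResidue (m := 1) (n := 1) ht.ne_one (by simp) (by simp) (by simp)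
    ⟨o * s, s, f, hfs.symm, ho.desc_left, hosf, ?_, ?_⟩
  · rw [Function.iterate_one, h2.PiMap_eq_of_ord_eq_two ht hf htf,
      mul_mul_self_of_mem_range ht.1, inv_mul_cancel_left]
    exact mem_closure_pair_right s f
  · rw [Function.iterate_one, h2.PiMap_eq_of_ord_eq_two ho.desc_right hg htf,
      mul_mul_self_of_mem_range ht.1]
    nth_rw 2 [← hss]
    rw [mul_assoc (o * s), inv_mul_cancel_left]
    exact mul_mem (mem_closure_pair_left s f) (mem_closure_pair_right s f)

theorem TwoDimensional.not_desc_two_two (h2 : TwoDimensional cs) (ho : IsBottom cs o s t)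
    (ht : Desc cs (o * s * t) t) (hf : Desc cs (o * s * t) f) (htf : ord t f = 2)
    (hs : Desc cs (o * t * s) s) (hg : Desc cs (o * t * s) g) (hsg : ord s g = 2)
    (hfs : f ≠ s) (hft : f ≠ t) (hgs : g ≠ s) (hgt : g ≠ t) : False := by
  have hosf : Desc cs (o * s) f := by
    have := ht.mul hf hft.symm
    rwa [mul_mul_self_of_mem_range ht.1] at this
  have hotg : Desc cs (o * t) g := by
    have := hs.mul hg hgs.symm
    rwa [mul_mul_self_of_mem_range hs.1] at this
  by_cases hfg : f = g
  · rw [← hfg] at hsg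
    exact h2.not_ord_eq_two_and ho hf.1 hfs hft hsg htf
  · exact h2.ord_ne_two_of_isBottom ho hosf hotg hfs hft hgt hfg htf

theorem TwoDimensional.descends_one_one_of_ord_eq_two (h2 : TwoDimensional cs)
    (ho : IsBottom cs o s t) (hf : Desc cs (o * s) f) (hf' : Desc cs (o * t) f)
    (hft : f ≠ t) (hsf : ord s f = 2) : Descends cs (o * s) (o * t) := by
  refine .of_sameResidue (m := 1) (n := 1) ho.desc_left.ne_one (by simp) (by simp) (by simp)
    ⟨o * t, t, f, hft.symm, ho.desc_right, hf', ?_, h2.PiMap_mem ho.desc_right hf' hft.symm⟩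
  rw [Function.iterate_one, h2.PiMap_eq_of_ord_eq_two ho.desc_left hf hsf,
    mul_mul_self_of_mem_range ho.left_mem]
  nth_rw 2 [← mul_mul_self_of_mem_range ho.right_mem o]
  rw [mul_assoc (o * t), inv_mul_cancel_left]
  exact mul_mem (mem_closure_pair_left t f) (mem_closure_pair_right t f)

theorem TwoDimensional.descends_one_one_same (h2 : TwoDimensional cs)
    (ho : IsBottom cs o s t) (hf : Desc cs (o * s) f) (hf' : Desc cs (o * t) f)
    (hfs : f ≠ s) (hft : f ≠ t) : Descends cs (o * s) (o * t) := by
  have hsf := two_le_ord ho.desc_left hf hfs.symm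
  have htf := two_le_ord ho.desc_right hf' hft.symm
  rcases hsf.eq_or_lt' with hsf | hsf
  · exact h2.descends_one_one_of_ord_eq_two ho hf hf' hft hsf
  rcases htf.eq_or_lt' with htf | htf
  · exact (h2.descends_one_one_of_ord_eq_two ho.symm hf' hf hfs htf).symm
  have hofs : Desc cs (o * f) s := by
    have := ho.desc_left.mul_two hf hsf
    rwa [mul_mul_self_of_mem_range ho.left_mem] at this
  have hoft : Desc cs (o * f) t := by
    have := ho.desc_right.mul_two hf' htf
    rwa [mul_mul_self_of_mem_range ho.right_mem] at this
  have hst : ord s t ≠ 2 := fun hst ↦ by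
    have e := mul_comm_right_of_ord_eq_two ho.left_mem ho.right_mem hst o
    have hos_t : ¬ Desc cs (o * s) t := fun h ↦ by
      rcases h2.eq_or_eq_of_desc ho.desc_left hf hfs.symm h with e | e
      exacts [ho.ne e.symm, hft e.symm]
    have hot_s : ¬ Desc cs (o * t) s := fun h ↦ by
      rcases h2.eq_or_eq_of_desc ho.desc_right hf' hft.symm h with e | e
      exacts [ho.ne e, hfs e.symm]
    have h1 := desc_mul_self_of_not_desc ho.right_mem hos_t
    have h3 := desc_mul_self_of_not_desc ho.left_mem hot_s
    rw [← e] at h3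
    refine h2.not_desc_mul_of_ord_eq_two hst h3 h1 (b := f) ?_ ?_
    · rwa [e, mul_mul_self_of_mem_range ho.left_mem]
    · rwa [mul_mul_self_of_mem_range ho.right_mem]
  have hsf3 : ord s f = 3 := by
    by_contra hne
    have := ho.desc_left.mul_three hf (by omega)
    rw [mul_mul_self_of_mem_range ho.left_mem] at this
    have h1 := h2.ord_of_desc hofs hoft this ho.ne hft
    rw [ord_comm] at htf
    omega
  have htf3 : ord t f = 3 := by
    by_contra hne
    have := ho.desc_right.mul_three hf' (by omega)
    rw [mul_mul_self_of_mem_range ho.right_mem] at this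
    have h1 := h2.ord_of_desc hoft hofs this ho.ne.symm hfs
    rw [ord_comm t s, ord_comm f s] at h1
    omega
  refine .of_sameResidue (m := 1) (n := 1) ho.desc_left.ne_one (by simp) (by simp) (by simp)
    ⟨o * f, s, t, ho.ne, hofs, hoft, ?_, ?_⟩
  · rw [Function.iterate_one, h2.PiMap_eq_of_ord_eq_three ho.desc_left hf hsf3,
      mul_mul_self_of_mem_range ho.left_mem, inv_mul_cancel_left]
    exact mem_closure_pair_left s t
  · rw [Function.iterate_one, h2.PiMap_eq_of_ord_eq_three ho.desc_right hf' htf3,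
      mul_mul_self_of_mem_range ho.right_mem, inv_mul_cancel_left]
    exact mem_closure_pair_right s t

theorem TwoDimensional.descends_one_one_of_six_le (h2 : TwoDimensional cs)
    (ho : IsBottom cs o s t) (hf : Desc cs (o * s) f) (hg : Desc cs (o * t) g)
    (hfs : f ≠ s) (hft : f ≠ t) (hgt : g ≠ t) (hfg : f ≠ g) (hsf : ord s f = 2)
    (htg : ord t g = 3) (hfg' : ord f g = 2) (htf : 6 ≤ ord t f) :
    Descends cs (o * s) (o * t) := by
  have hof := ho.desc_bot hf hfs
  have hog := ho.symm.desc_bot hg hgt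
  have hogt : Desc cs (o * g) t := by
    have := ho.desc_right.mul_two hg htg.ge
    rwa [mul_mul_self_of_mem_range ho.right_mem] at this
  have hogf := hog.mul hof hfg.symm
  have hofg := hof.mul hog hfg
  have e := mul_comm_right_of_ord_eq_two hof.1 hog.1 hfg' o
  have hT : ∀ r, Desc cs (o * f) r → r = g := fun r hr ↦ by
    by_contra hrg
    have hrt : r ≠ t := by
      rintro rfl
      exact h2.not_desc_mul_of_ord_eq_two hfg' hof hog hr hogt
    have h1 := hofg.mul hr (Ne.symm hrg)
    rw [e] at h1
    have h3 := h2.ord_of_desc hogf hogt h1 hft hrt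
    rw [ord_comm f t] at h3
    omega
  refine .of_sameResidue (m := 2) (n := 1) ho.desc_left.ne_one (by simp) (by simp) (by simp)
    ⟨o * g, t, f, hft.symm, hogt, hogf, ?_, ?_⟩
  · change _ * PiMap cs (PiMap cs (o * s)) ∈ _
    rw [h2.PiMap_eq_of_ord_eq_two ho.desc_left hf hsf, mul_mul_self_of_mem_range ho.left_mem,
      PiMap_eq_of_forall_eq hofg hT, e, inv_mul_cancel_left]
    exact mem_closure_pair_right t f
  · rw [Function.iterate_one, h2.PiMap_eq_of_ord_eq_three ho.desc_right hg htg,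
      mul_mul_self_of_mem_range ho.right_mem, inv_mul_cancel_left]
    exact mem_closure_pair_left t f

theorem TwoDimensional.descends_one_one (h2 : TwoDimensional cs) (ho : IsBottom cs o s t)
    (hf : Desc cs (o * s) f) (hg : Desc cs (o * t) g) (hfs : f ≠ s) (hft : f ≠ t)
    (hgs : g ≠ s) (hgt : g ≠ t) : Descends cs (o * s) (o * t) := by
  by_cases hfg : f = g
  · subst hfg
    exact h2.descends_one_one_same ho hf hg hfs hft
  have hof := ho.desc_bot hf hfs
  have hog := ho.symm.desc_bot hg hgt
  have h1 := h2.ord_of_desc ho.desc_left hf (b := g)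
    (by rwa [mul_mul_self_of_mem_range ho.left_mem]) hfs.symm (Ne.symm hfg)
  have h3 := h2.ord_of_desc ho.desc_right hg (b := f)
    (by rwa [mul_mul_self_of_mem_range ho.right_mem]) hgt.symm hfg
  rcases h1 with hsf | ⟨hsf, hgf, hsg⟩ <;> rcases h3 with htg | ⟨htg, hfg', htf⟩
  · refine .of_sameResidue (m := 1) (n := 1) ho.desc_left.ne_one (by simp) (by simp) (by simp)
      ⟨o, f, g, hfg, hof, hog, ?_, ?_⟩
    · rw [Function.iterate_one, h2.PiMap_eq_of_ord_eq_two ho.desc_left hf hsf,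
        mul_mul_self_of_mem_range ho.left_mem, inv_mul_cancel_left]
      exact mem_closure_pair_left f g
    · rw [Function.iterate_one, h2.PiMap_eq_of_ord_eq_two ho.desc_right hg htg,
        mul_mul_self_of_mem_range ho.right_mem, inv_mul_cancel_left]
      exact mem_closure_pair_right f g
  · exact h2.descends_one_one_of_six_le ho hf hg hfs hft hgt hfg hsf htg hfg' htf
  · exact (h2.descends_one_one_of_six_le ho.symm hg hf hgt hgs hfs (Ne.symm hfg) htg hsf
      hgf hsg).symm
  · have hogt : Desc cs (o * g) t := by
      have := ho.desc_right.mul_two hg htg.ge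
      rwa [mul_mul_self_of_mem_range ho.right_mem] at this
    have hofs : Desc cs (o * f) s := by
      have := ho.desc_left.mul_two hf hsf.ge
      rwa [mul_mul_self_of_mem_range ho.left_mem] at this
    have h1 := (hof.mul hog hfg).mul hofs hgs
    rw [mul_comm_right_of_ord_eq_two hof.1 hog.1 hfg'] at h1
    have h3 := h2.ord_of_desc (hog.mul hof (Ne.symm hfg)) hogt h1 hft ho.ne
    rw [ord_comm f t] at h3
    omega

end Descends

section Merge

variable {cs : CoxeterSystem M W} {x y f g o s t h : W}

theorem Leaves.isGate (ho : IsBottom cs o s t) (ht : Desc cs (o * s * t) t)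
    (hf : Desc cs (o * s * t) f) (hsf : ord s f = 2) (htf : ord t f = 3) (hst : 6 ≤ ord s t) :
    IsGate cs o s t f :=
  { ho with desc := ht, desc' := hf, ord_left := hsf, ord_right := htf, six_le := hst }

theorem Leaves.mem_of_same (h : Leaves cs o s t f x) :
    x = o * s ∨ x = o * s * t ∨ x = o * s * t * s := by
  cases h with
  | one => exact .inl rfl
  | two => exact .inr (.inl rfl)
  | three _ _ _ _ _ h => exact .inr h

theorem Leaves.mem_of_isGate (h2 : TwoDimensional cs) (hg : IsGate cs o s t g)
    (h : Leaves cs o t s f x) : x = o * t ∨ x = o * t * s := by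
  cases h with
  | one => exact .inl rfl
  | two => exact .inr rfl
  | three hs hf htf hsf hts hx =>
    have h' := Leaves.isGate hg.toIsBottom.symm hs hf htf hsf hts
    have := hg.eq_of_desc_bot h2 h'.desc_bot
    rw [this, hg.ord_left] at hsf
    omega

theorem TwoDimensional.descends_bot (h2 : TwoDimensional cs) (ho : IsBottom cs o s t)
    (h : Leaves cs o s t f x) (hfs : f ≠ s) : Descends cs x o := by
  cases h with
  | one hf =>
    have := h2.descends_mul ho.desc_left hf hfs
    rwa [mul_mul_self_of_mem_range ho.left_mem] at this
  | two ht hf htf =>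
    have := h2.descends_mul_mul (s := s) ht hf htf
      (by rw [mul_mul_self_of_mem_range ht.1]; exact ho.desc_left) hfs
    rwa [mul_mul_self_of_mem_range ho.right_mem, mul_mul_self_of_mem_range ho.left_mem] at this
  | three ht hf hsf htf hst hx =>
    refine (Leaves.isGate ho ht hf hsf htf hst).descends h2 (.inl (.inr (.inr hx)))
      (.inl (.inl rfl))

theorem TwoDimensional.eq_or_descends_same (h2 : TwoDimensional cs) (ho : IsBottom cs o s t)
    (hx : Leaves cs o s t f x) (hy : Leaves cs o s t g y) (hft : f ≠ t) (hgt : g ≠ t) :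
    x = y ∨ Descends cs x y := by
  have hx' := hx.mem_of_same
  have hy' := hy.mem_of_same
  cases hx with
  | three ht hf hsf htf hst hx =>
    exact .inr ((Leaves.isGate ho ht hf hsf htf hst).descends h2 (.inl (.inr hx'))
        (.inl (.inr hy')))
  | one hf =>
    cases hy with
    | three ht hf hsf htf hst hx =>
      exact .inr ((Leaves.isGate ho ht hf hsf htf hst).descends h2 (.inl (.inr hx'))
        (.inl (.inr hy')))
    | one => exact .inl rfl
    | two ht hg htg =>
      have := h2.descends_mul ht hg hgt
      rw [mul_mul_self_of_mem_range ho.right_mem] at this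
      exact .inr this.symm
  | two ht hf htf =>
    cases hy with
    | three ht hf hsf htf hst hx =>
      exact .inr ((Leaves.isGate ho ht hf hsf htf hst).descends h2 (.inl (.inr hx'))
        (.inl (.inr hy')))
    | one =>
      have := h2.descends_mul ht hf hft
      rw [mul_mul_self_of_mem_range ho.right_mem] at this
      exact .inr this
    | two => exact .inl rfl

theorem TwoDimensional.descends_opposite (h2 : TwoDimensional cs) (ho : IsBottom cs o s t)
    (hx : Leaves cs o s t f x) (hy : Leaves cs o t s g y) (hfs : f ≠ s) (hft : f ≠ t)
    (hgs : g ≠ s) (hgt : g ≠ t) : Descends cs x y := by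
  have hx' := hx.mem_of_same
  have hy' := hy.mem_of_same
  have hx'' := hx
  cases hx with
  | three ht hf hsf htf hst hx =>
    have hG := Leaves.isGate ho ht hf hsf htf hst
    have := hy.mem_of_isGate h2 hG
    exact hG.descends h2 (.inl (.inr hx')) (.inr this)
  | one hf =>
    cases hy with
    | three ht hg hsf htf hst hx =>
      have hG := Leaves.isGate ho.symm ht hg hsf htf hst
      have := hx''.mem_of_isGate h2 hG
      exact hG.descends h2 (.inr this) (.inl (.inr hy'))
    | one hg => exact h2.descends_one_one ho hf hg hfs hft hgs hgt
    | two hs hg hsg =>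
      exact (h2.descends_two_one ho.symm hs hg hsg hf hgt hgs hfs).symm
  | two ht hf htf =>
    cases hy with
    | three ht hg hsf htf hst hx =>
      have hG := Leaves.isGate ho.symm ht hg hsf htf hst
      have := hx''.mem_of_isGate h2 hG
      exact hG.descends h2 (.inr this) (.inl (.inr hy'))
    | one hg => exact h2.descends_two_one ho ht hf htf hg hfs hft hgt
    | two hs hg hsg =>
      exact (h2.not_desc_two_two ho ht hf htf hs hg hsg hfs hft hgs hgt).elim

/-- Two distinct elements of a finite rank two residue can be moved by iterates of `Π` into a
common finite rank two residue closer to the identity. -/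
theorem SameResidue.eq_or_descends (h2 : TwoDimensional cs) (h : SameResidue cs x y) :
    x = y ∨ Descends cs x y := by
  obtain ⟨o, s, t, ho, hx, hy⟩ := h.exists_isBottom
  rcases h2.cases_of_mem_residue ho hx with rfl | ⟨hx1, hx'⟩ | ⟨f, hfs, hft, hf⟩
  · rcases h2.cases_of_mem_residue ho hy with rfl | ⟨hy1, hy'⟩ | ⟨g, hgs, hgt, hg | hg⟩
    · exact .inl rfl
    · exact .inr (Descends.of_sameResidue (m := 1) (n := 0) hy1 (by simp) (by simp) (by simp)
        (ho.sameResidue hy' hx)).symm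
    · exact .inr (h2.descends_bot ho hg hgs).symm
    · exact .inr (h2.descends_bot ho.symm hg hgt).symm
  · exact .inr (.of_sameResidue (m := 1) (n := 0) hx1 (by simp) (by simp) (by simp)
      (ho.sameResidue hx' hy))
  rcases h2.cases_of_mem_residue ho hy with rfl | ⟨hy1, hy'⟩ | ⟨g, hgs, hgt, hg⟩
  · rcases hf with hf | hf
    exacts [.inr (h2.descends_bot ho hf hfs), .inr (h2.descends_bot ho.symm hf hft)]
  · exact .inr (Descends.of_sameResidue (m := 1) (n := 0) hy1 (by simp) (by simp) (by simp)
      (ho.sameResidue hy' hx)).symm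
  · rcases hf with hf | hf <;> rcases hg with hg | hg
    · exact h2.eq_or_descends_same ho hf hg hft hgt
    · exact .inr (h2.descends_opposite ho hf hg hfs hft hgs hgt)
    · exact .inr (h2.descends_opposite ho.symm hf hg hft hfs hgt hgs)
    · exact h2.eq_or_descends_same ho.symm hf hg hfs hgs

end Merge

section WordDist

variable {cs : CoxeterSystem M W} {x y s w : W} {v v' : List B} {K : ℕ}

/-- The word metric on `W`. -/
noncomputable def wordDist (cs : CoxeterSystem M W) (x y : W) : ℕ := cs.length (x⁻¹ * y)

theorem wordDist_self (x : W) : wordDist cs x x = 0 := by simp [wordDist]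

theorem wordDist_comm (x y : W) : wordDist cs x y = wordDist cs y x := by
  rw [wordDist, ← cs.length_inv, mul_inv_rev, inv_inv, wordDist]

theorem wordDist_triangle (x y z : W) : wordDist cs x z ≤ wordDist cs x y + wordDist cs y z := by
  have := cs.length_mul_le (x⁻¹ * y) (y⁻¹ * z)
  rwa [mul_assoc, mul_inv_cancel_left] at this

theorem length_le_length_add_wordDist (x y : W) :
    cs.length y ≤ cs.length x + wordDist cs x y := by
  have := cs.length_mul_le x (x⁻¹ * y)
  rwa [mul_inv_cancel_left] at this

theorem wordDist_mul (x w : W) : wordDist cs x (x * w) = cs.length w := by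
  rw [wordDist, inv_mul_cancel_left]

theorem exists_length_le_of_mem_descSubgroup (cs : CoxeterSystem M W) :
    ∃ K, 1 ≤ K ∧ ∀ x : W, ∀ w ∈ descSubgroup cs x, cs.length w ≤ K := by
  have h : ∀ J : Set B, ∃ k, ∀ x : W, descentSet cs x = J → ∀ w ∈ descSubgroup cs x,
      cs.length w ≤ k := by
    intro J
    by_cases hJ : ∃ x, descentSet cs x = J
    · obtain ⟨x, rfl⟩ := hJ
      refine ⟨cs.length (wg cs x), fun y hy w hw ↦ (wg_mem_and_length_le x).2 w ?_⟩
      rwa [descSubgroup, ← hy]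
    · exact ⟨0, fun x hx ↦ absurd ⟨x, hx⟩ hJ⟩
  choose k hk using h
  obtain ⟨K, hK⟩ := (Set.finite_range k).bddAbove
  exact ⟨K + 1, by simp, fun x w hw ↦
    (hk _ x rfl w hw).trans ((hK ⟨_, rfl⟩).trans (Nat.le_succ K))⟩

theorem wordDist_iterate_PiMap_le (hK : ∀ x : W, ∀ w ∈ descSubgroup cs x, cs.length w ≤ K)
    (x : W) (n : ℕ) : wordDist cs x ((PiMap cs)^[n] x) ≤ n * K := by
  induction n with
  | zero => simp [wordDist_self]
  | succ n ih =>
    rw [Function.iterate_succ_apply', add_mul, one_mul]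
    refine (wordDist_triangle _ ((PiMap cs)^[n] x) _).trans (add_le_add ih ?_)
    rw [PiMap, wordDist_mul]
    exact hK _ _ (wg_mem_and_length_le _).1

theorem SameResidue.wordDist_le (hK : ∀ x : W, ∀ w ∈ descSubgroup cs x, cs.length w ≤ K)
    (h : SameResidue cs x y) : wordDist cs x y ≤ K := by
  obtain ⟨u, a, b, -, ha, hb, hx, hy⟩ := h
  refine hK u _ ?_
  have := mul_mem (inv_mem hx) hy
  rw [mul_inv_rev, inv_inv, mul_assoc, mul_inv_cancel_left] at this
  rw [descSubgroup_eq]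
  exact Subgroup.closure_mono (desc_of_mem_pair ha hb) this

theorem SameResidue.exists_wordDist_iterate_le (h2 : TwoDimensional cs)
    (hK : ∀ x : W, ∀ w ∈ descSubgroup cs x, cs.length w ≤ K) (h : SameResidue cs x y) (n : ℕ) :
    ∃ k, wordDist cs ((PiMap cs)^[n] x) ((PiMap cs)^[k] y) ≤ 3 * K := by
  induction hl : cs.length x + cs.length y using Nat.strong_induction_on generalizing x y n with
  | _ l ih =>
    rcases h.eq_or_descends h2 with rfl | ⟨i, hi, j, -, h', hlt⟩
    · exact ⟨n, by simp [wordDist_self]⟩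
    rcases lt_or_ge n i with hn | hn
    · refine ⟨0, ?_⟩
      have h1 := wordDist_iterate_PiMap_le hK x n
      rw [wordDist_comm] at h1
      have h3 := wordDist_triangle (cs := cs) ((PiMap cs)^[n] x) x y
      have h4 := h.wordDist_le hK
      have h5 : n * K ≤ 2 * K := Nat.mul_le_mul_right K (by omega)
      rw [Function.iterate_zero, id]
      omega
    · obtain ⟨k, hk⟩ := ih _ (hl ▸ hlt) h' (n - i) rfl
      rw [← Function.iterate_add_apply, ← Function.iterate_add_apply, Nat.sub_add_cancel hn] at hk
      exact ⟨_, hk⟩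

theorem Desc.exists_wordDist_iterate_le (h2 : TwoDimensional cs) (hK1 : 1 ≤ K)
    (hK : ∀ x : W, ∀ w ∈ descSubgroup cs x, cs.length w ≤ K) (h : Desc cs x s) (n : ℕ) :
    (∃ k, wordDist cs ((PiMap cs)^[n] x) ((PiMap cs)^[k] (x * s)) ≤ 3 * K) ∧
      ∃ k, wordDist cs ((PiMap cs)^[n] (x * s)) ((PiMap cs)^[k] x) ≤ 3 * K := by
  by_cases ht : ∃ t, Desc cs x t ∧ t ≠ s
  · obtain ⟨t, ht, hts⟩ := ht
    have : SameResidue cs x (x * s) := ⟨x, s, t, hts.symm, h, ht, by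
      rw [inv_mul_cancel]
      exact one_mem _, by
      rw [inv_mul_cancel_left]
      exact mem_closure_pair_left s t⟩
    exact ⟨this.exists_wordDist_iterate_le h2 hK n, this.symm.exists_wordDist_iterate_le h2 hK n⟩
  · push Not at ht
    rw [← PiMap_eq_of_forall_eq h ht]
    refine ⟨?_, n + 1, ?_⟩
    · cases n with
      | zero =>
        refine ⟨0, ?_⟩
        rw [Function.iterate_zero, id, id, PiMap_eq_of_forall_eq h ht, wordDist_mul,
          length_of_mem_range h.1]
        omega
      | succ n => exact ⟨n, by simp [wordDist_self]⟩
    · simp [wordDist_self]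

theorem exists_wordDist_iterate_mul_le (h2 : TwoDimensional cs) (hK1 : 1 ≤ K)
    (hK : ∀ x : W, ∀ w ∈ descSubgroup cs x, cs.length w ≤ K) (hs : s ∈ Set.range cs.simple)
    (x : W) (n : ℕ) :
    ∃ k, wordDist cs ((PiMap cs)^[n] x) ((PiMap cs)^[k] (x * s)) ≤ 3 * K := by
  by_cases h : Desc cs x s
  · exact (h.exists_wordDist_iterate_le h2 hK1 hK n).1
  · have := ((desc_mul_self_of_not_desc hs h).exists_wordDist_iterate_le h2 hK1 hK n).2
    rwa [mul_mul_self_of_mem_range hs] at this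

end WordDist

section StdLang

variable {cs : CoxeterSystem M W} {v v' : List B} {K : ℕ}

theorem wordProd_take_of_wordProd_drop
    (h : cs.wordProd (v.drop (v.length - cs.length (wg cs (cs.wordProd v)))) =
      wg cs (cs.wordProd v)) :
    cs.wordProd (v.take (v.length - cs.length (wg cs (cs.wordProd v)))) =
      PiMap cs (cs.wordProd v) := by
  have := cs.wordProd_append (v.take (v.length - cs.length (wg cs (cs.wordProd v))))
    (v.drop (v.length - cs.length (wg cs (cs.wordProd v))))
  rw [List.take_append_drop, h] at this
  rw [eq_mul_inv_of_mul_eq this.symm, wg_inv, PiMap]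

theorem length_wg_le_length (v : List B) : cs.length (wg cs (cs.wordProd v)) ≤ v.length := by
  have h1 := length_PiMap (cs := cs) (cs.wordProd v)
  have h2 := cs.length_wordProd_le v
  omega

theorem StdLang.isReduced (h : StdLang cs v) : cs.IsReduced v := by
  induction h with
  | nil => simp [CoxeterSystem.IsReduced]
  | step v hne hpre hsuf ih =>
    rw [CoxeterSystem.IsReduced, wordProd_take_of_wordProd_drop hsuf, List.length_take] at ih
    have h1 := length_PiMap (cs := cs) (cs.wordProd v)
    have h2 := length_wg_le_length (cs := cs) v
    rw [CoxeterSystem.IsReduced]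
    omega

theorem wordDist_wordProd_take_le (v : List B) {i j : ℕ} (hij : i ≤ j) :
    wordDist cs (cs.wordProd (v.take i)) (cs.wordProd (v.take j)) ≤ min j v.length - i := by
  obtain ⟨k, rfl⟩ := Nat.exists_eq_add_of_le hij
  rw [List.take_add, cs.wordProd_append, wordDist_mul]
  refine (cs.length_wordProd_le _).trans ?_
  rw [List.length_take, List.length_drop]
  omega

theorem StdLang.wordProd_take_length_iterate (h : StdLang cs v) (n : ℕ) :
    cs.wordProd (v.take (cs.length ((PiMap cs)^[n] (cs.wordProd v)))) =
      (PiMap cs)^[n] (cs.wordProd v) := by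
  have hred := h.isReduced
  induction h generalizing n with
  | nil => simp [Function.iterate_fixed PiMap_one]
  | step v hne hpre hsuf ih =>
    cases n with
    | zero => rw [Function.iterate_zero, id, hred.eq, List.take_length]
    | succ n =>
      have ih := ih n hpre.isReduced
      have h1 := length_PiMap (cs := cs) (cs.wordProd v)
      have h2 := length_iterate_PiMap_le (cs := cs) n (PiMap cs (cs.wordProd v))
      rw [wordProd_take_of_wordProd_drop hsuf, List.take_take, min_eq_left] at ih
      · exact ih
      · have := hred.eq
        omega

theorem StdLang.exists_wordDist_wordProd_take_le
    (hK : ∀ x : W, ∀ w ∈ descSubgroup cs x, cs.length w ≤ K) (h : StdLang cs v) (n : ℕ) :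
    ∃ k, wordDist cs (cs.wordProd (v.take n)) ((PiMap cs)^[k] (cs.wordProd v)) ≤ K := by
  induction h generalizing n with
  | nil => exact ⟨0, by simp [wordDist_self]⟩
  | step v hne hpre hsuf ih =>
    rcases le_total n (v.length - cs.length (wg cs (cs.wordProd v))) with hn | hn
    · obtain ⟨k, hk⟩ := ih n
      rw [wordProd_take_of_wordProd_drop hsuf, List.take_take, min_eq_left hn] at hk
      exact ⟨k + 1, hk⟩
    · refine ⟨1, ?_⟩
      rw [Function.iterate_one, ← wordProd_take_of_wordProd_drop hsuf, wordDist_comm]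
      refine (wordDist_wordProd_take_le v hn).trans ?_
      have := hK _ _ (wg_mem_and_length_le (cs := cs) (cs.wordProd v)).1
      omega

theorem StdLang.wordDist_wordProd_take_le (h2 : TwoDimensional cs) (hK1 : 1 ≤ K)
    (hK : ∀ x : W, ∀ w ∈ descSubgroup cs x, cs.length w ≤ K) {i : B} (hv : StdLang cs v)
    (hv' : StdLang cs v') (h : cs.wordProd v' = cs.wordProd v * cs.simple i) (n : ℕ) :
    wordDist cs (cs.wordProd (v.take n)) (cs.wordProd (v'.take n)) ≤ 8 * K + 1 := by
  obtain ⟨k, hk⟩ := hv.exists_wordDist_wordProd_take_le hK n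
  obtain ⟨l, hl⟩ := exists_wordDist_iterate_mul_le h2 hK1 hK ⟨i, rfl⟩ (cs.wordProd v) k
  rw [← h, ← hv'.wordProd_take_length_iterate l] at hl
  have hj := length_iterate_PiMap_le (cs := cs) l (cs.wordProd v')
  set j := cs.length ((PiMap cs)^[l] (cs.wordProd v'))
  have hd := (wordDist_triangle _ _ _).trans (add_le_add hk hl)
  have hvn := (hv.isReduced.take n).eq
  have hvj := (hv'.isReduced.take j).eq
  have hlen := cs.length_mul_simple (cs.wordProd v) i
  rw [← h, hv.isReduced.eq, hv'.isReduced.eq] at hlen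
  rw [hv'.isReduced.eq] at hj
  rw [List.length_take] at hvn hvj
  have h3 := length_le_length_add_wordDist (cs := cs) (cs.wordProd (v.take n))
    (cs.wordProd (v'.take j))
  have h4 := length_le_length_add_wordDist (cs := cs) (cs.wordProd (v'.take j))
    (cs.wordProd (v.take n))
  rw [wordDist_comm] at h4
  refine (wordDist_triangle _ (cs.wordProd (v'.take j)) _).trans ?_
  rcases le_total j n with hjn | hjn
  · have := CoxeterPaper.wordDist_wordProd_take_le (cs := cs) v' hjn
    omega
  · have := CoxeterPaper.wordDist_wordProd_take_le (cs := cs) v' hjn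
    rw [wordDist_comm] at this
    omega

end StdLang

/-- **Corollary.** For a 2-dimensional Coxeter group, the standard language satisfies
condition (ii) of the definition of biautomaticity. -/
theorem standard_language_part_ii
    (cs : CoxeterSystem M W) (h2 : TwoDimensional cs) :
    ∃ C : ℕ, 0 < C ∧
      (∀ (i : B) (g g' : W), g' = g * cs.simple i →
        ∀ v v' : List B, StdLang cs v → StdLang cs v' →
          cs.wordProd v = g → cs.wordProd v' = g' →
          ∀ n : ℕ, 1 ≤ n →
            cs.length ((cs.wordProd (v.take n))⁻¹ * cs.wordProd (v'.take n)) ≤ C) := by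
  obtain ⟨K, hK1, hK⟩ := exists_length_le_of_mem_descSubgroup cs
  refine ⟨8 * K + 1, by omega, fun i g g' hg v v' hv hv' h h' n _ ↦ ?_⟩
  exact hv.wordDist_wordProd_take_le h2 hK1 hK hv' (by rw [h', hg, h]) n

end CoxeterPaper
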